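/- If α + n is OTM-clockable for some natural number n, then α is OTM-clockable. -/

import Mathlib

open Ordinal

noncomputable section

/-- liminf at `α` of an ordinal-indexed sequence of ordinals:
the sup over `γ < α` of the inf of the values on `[γ, α)`. -/
noncomputable def liminfAt (α : Ordinal.{0}) (p : Ordinal.{0} → Ordinal.{0}) : Ordinal :=
  ⨆ γ : Set.Iio α, sInf (p '' {i | γ.1 ≤ i ∧ i < α})

/-- liminf at `α` of a `Bool`-valued sequence (with `false < true`):
`true` iff the value is eventually `true` before `α`. -/
noncomputable def boolLiminfAt (α : Ordinal.{0}) (b : Ordinal.{0} → Bool) : Bool :=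
  open scoped Classical in
  if (∃ γ < α, ∀ i, γ ≤ i → i < α → b i = true) then true else false

/-- liminf at `α` of a `ℕ`-valued sequence, with the convention that an
unbounded sequence has liminf `0` (reset/overflow rule). -/
noncomputable def natLiminfAt (α : Ordinal.{0}) (s : Ordinal.{0} → ℕ) : ℕ :=
  (liminfAt α (fun i => (s i : Ordinal))).card.toNat

open scoped Classical in
/-- Moving a head one step to the left: predecessor at successors, `0` at `0` and at limits. -/
noncomputable def leftOf (o : Ordinal.{0}) : Ordinal :=
  if h : ∃ p, o = p + 1 then Classical.choose h else 0

/-- A program for an Ordinal Turing Machine (Koepke), with finitely many tapes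
(of proper-class length) and finitely many states.  `trans` maps the current state
and the symbols read by the heads either to `none` (halt) or to a new state, the
symbols to be written, and for each tape the direction of head movement
(`true` = right, `false` = left). -/
structure OTMProgram where
  tapes : ℕ
  states : ℕ
  trans : Fin (states + 1) → (Fin tapes → Bool) →
    Option (Fin (states + 1) × (Fin tapes → Bool) × (Fin tapes → Bool))

/-- A configuration of an OTM: inner state, head positions and tape contents. -/
structure OTMConfig (P : OTMProgram) where
  state : Fin (P.states + 1)
  head : Fin P.tapes → Ordinal.{0}
  tape : Fin P.tapes → Ordinal.{0} → Bool

namespace OTMProgram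

variable (P : OTMProgram)

/-- The symbols currently read by the heads. -/
def readSymbols (c : OTMConfig P) : Fin P.tapes → Bool :=
  fun t => c.tape t (c.head t)

/-- One computation step; a halted configuration stays unchanged. -/
noncomputable def stepConfig (c : OTMConfig P) : OTMConfig P :=
  match P.trans c.state (P.readSymbols c) with
  | none => c
  | some (s', w, mv) =>
      { state := s'
        head := fun t => if mv t then c.head t + 1 else leftOf (c.head t)
        tape := fun t i => if i = c.head t then w t else c.tape t i }

/-- The configuration at a limit time, determined by the liminf rules for the
state, the head positions and the cell contents. -/
noncomputable def limitConfig (lam : Ordinal.{0}) (g : ∀ β, β < lam → OTMConfig P) :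
    OTMConfig P :=
  { state := ⟨natLiminfAt lam
        (fun i => if h : i < lam then ((g i h).state : ℕ) else 0) % (P.states + 1),
      Nat.mod_lt _ (Nat.succ_pos _)⟩
    head := fun t => liminfAt lam (fun i => if h : i < lam then (g i h).head t else 0)
    tape := fun t j =>
      boolLiminfAt lam (fun i => if h : i < lam then (g i h).tape t j else false) }

/-- The initial configuration: state `0`, all heads on cell `0`, empty tapes. -/
def initConfig : OTMConfig P :=
  { state := ⟨0, Nat.succ_pos _⟩, head := fun _ => 0, tape := fun _ _ => false }

/-- The run of an OTM-program (on empty input, without parameters):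
the configuration at each ordinal time. -/
noncomputable def run (o : Ordinal.{0}) : OTMConfig P :=
  Ordinal.limitRecOn o P.initConfig (fun _ ih => P.stepConfig ih)
    (fun lam _ ih => P.limitConfig lam ih)

/-- The machine is in a halting configuration at time `τ`. -/
def haltedAt (τ : Ordinal.{0}) : Prop :=
  P.trans (P.run τ).state (P.readSymbols (P.run τ)) = none

/-- The machine halts exactly at time `τ`. -/
def haltsAt (τ : Ordinal.{0}) : Prop :=
  P.haltedAt τ ∧ ∀ σ < τ, ¬ P.haltedAt σ

end OTMProgram

/-- An ordinal `α` is OTM-clockable iff some OTM-program halts at time `α + 1`. -/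
def OTMClockable (α : Ordinal.{0}) : Prop :=
  ∃ P : OTMProgram, P.haltsAt (α + 1)

/-- `α` is closed under ordinal exponentiation. -/
def ExpClosed (α : Ordinal.{0}) : Prop :=
  ∀ β < α, ∀ γ < α, β ^ γ < α



/-! ### Ordinal and liminf preliminaries -/

theorem leftOf_add_one (x : Ordinal.{0}) : leftOf (x + 1) = x := by
  have h : ∃ p, x + 1 = p + 1 := ⟨x, rfl⟩
  unfold leftOf
  rw [dif_pos h]
  have := Classical.choose_spec h
  exact (Order.succ_injective (by rw [Order.succ_eq_add_one, Order.succ_eq_add_one]; exact this)).symm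

theorem leftOf_zero : leftOf 0 = 0 := by
  unfold leftOf
  rw [dif_neg]
  rintro ⟨p, hp⟩
  exact absurd hp.symm (by simp)

theorem leftOf_limit {x : Ordinal.{0}} (h : Order.IsSuccLimit x) : leftOf x = 0 := by
  unfold leftOf
  rw [dif_neg]
  rintro ⟨p, rfl⟩
  exact absurd h (by rw [← Order.succ_eq_add_one]; exact Order.not_isSuccLimit_succ p)

theorem ord_cases (x : Ordinal.{0}) : x = 0 ∨ (∃ y, x = y + 1) ∨ Order.IsSuccLimit x := by
  rcases Ordinal.zero_or_succ_or_isSuccLimit x with h | ⟨y, h⟩ | h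
  · exact Or.inl h
  · exact Or.inr (Or.inl ⟨y, by rw [← h, Order.succ_eq_add_one]⟩)
  · exact Or.inr (Or.inr h)

theorem leftOf_le (x : Ordinal.{0}) : leftOf x ≤ x := by
  rcases ord_cases x with rfl | ⟨y, rfl⟩ | h
  · rw [leftOf_zero]
  · rw [leftOf_add_one]; exact le_self_add
  · rw [leftOf_limit h]; exact zero_le

theorem lt_liminfAt {lam : Ordinal.{0}} {p : Ordinal.{0} → Ordinal.{0}} {y : Ordinal.{0}} :
    y < liminfAt lam p ↔ ∃ γ < lam, ∀ i, γ ≤ i → i < lam → y < p i := by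
  unfold liminfAt
  rw [Ordinal.lt_iSup_iff]
  constructor
  · rintro ⟨γ, h⟩
    refine ⟨γ.1, γ.2, fun i h1 h2 => lt_of_lt_of_le h (csInf_le' ⟨i, ⟨h1, h2⟩, rfl⟩)⟩
  · rintro ⟨γ, hγ, h⟩
    refine ⟨⟨γ, hγ⟩, ?_⟩
    have hne : (p '' {i | γ ≤ i ∧ i < lam}).Nonempty := ⟨p γ, γ, ⟨le_rfl, hγ⟩, rfl⟩
    obtain ⟨i, ⟨h1, h2⟩, h3⟩ := csInf_mem hne
    show y < sInf (p '' {i | γ ≤ i ∧ i < lam})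
    rw [← h3]
    exact h i h1 h2

theorem liminfAt_congr {lam : Ordinal.{0}} {p q : Ordinal.{0} → Ordinal.{0}}
    (h : ∀ i < lam, p i = q i) : liminfAt lam p = liminfAt lam q := by
  apply eq_of_forall_lt_iff
  intro y
  rw [lt_liminfAt, lt_liminfAt]
  constructor
  · rintro ⟨γ, h1, h2⟩
    exact ⟨γ, h1, fun i a b => by rw [← h i b]; exact h2 i a b⟩
  · rintro ⟨γ, h1, h2⟩
    exact ⟨γ, h1, fun i a b => by rw [h i b]; exact h2 i a b⟩

theorem boolLiminfAt_true {lam : Ordinal.{0}} {b : Ordinal.{0} → Bool} :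
    boolLiminfAt lam b = true ↔ ∃ γ < lam, ∀ i, γ ≤ i → i < lam → b i = true := by
  unfold boolLiminfAt
  split_ifs with h
  · simp [h]
  · simp [h]

/-- Some value at arbitrarily late times is at most the liminf. -/
theorem exists_le_liminfAt {lam : Ordinal.{0}} (p : Ordinal.{0} → Ordinal.{0})
    {γ : Ordinal.{0}} (hγ : γ < lam) : ∃ i, γ ≤ i ∧ i < lam ∧ p i ≤ liminfAt lam p := by
  by_contra hcon
  push Not at hcon
  exact lt_irrefl _ (lt_liminfAt.2 ⟨γ, hγ, hcon⟩)

/-! times of the form `2 * σ` and `2 * σ + 1` -/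

theorem two_mul_succ (σ : Ordinal.{0}) : 2 * (σ + 1) = 2 * σ + 1 + 1 := by
  rw [mul_add, mul_one, add_assoc, one_add_one_eq_two]

theorem two_mul_limit {lam : Ordinal.{0}} (h : Order.IsSuccLimit lam) : 2 * lam = lam := by
  obtain ⟨a, rfl⟩ := (Ordinal.isSuccPrelimit_iff_omega0_dvd.1 h.isSuccPrelimit)
  rw [← mul_assoc]
  have := Ordinal.natCast_mul_omega0 (n := 2) (by norm_num)
  rw [Nat.cast_ofNat] at this
  rw [this]

theorem half_cases (j : Ordinal.{0}) : ∃ σ, j = 2 * σ ∨ j = 2 * σ + 1 := by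
  refine ⟨j / 2, ?_⟩
  have h1 := Ordinal.div_add_mod j 2
  have h2 : j % 2 < 2 := Ordinal.mod_lt j (by norm_num)
  have h3 : j % 2 = 0 ∨ j % 2 = 1 := by
    have h2 : j % 2 ≤ 1 := by
      apply Order.lt_add_one_iff.1
      rw [one_add_one_eq_two]; exact h2
    rcases h2.lt_or_eq with h | h
    · left; exact Order.lt_one_iff.1 h
    · right; exact h
  rcases h3 with h | h
  · left; rw [h, add_zero] at h1; exact h1.symm
  · right; rw [h] at h1; exact h1.symm

theorem le_two_mul (σ : Ordinal.{0}) : σ ≤ 2 * σ := by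
  conv_lhs => rw [← one_mul σ]
  exact mul_le_mul_left (by norm_num) σ

theorem half_le {γ σ : Ordinal.{0}} (h : 2 * γ ≤ 2 * σ + 1) : γ ≤ σ := by
  by_contra hc
  push Not at hc
  have : 2 * (σ + 1) ≤ 2 * γ := mul_le_mul_right (Order.add_one_le_of_lt hc) 2
  rw [two_mul_succ] at this
  exact absurd (this.trans h) (not_le.2 (Order.lt_add_one_iff.2 le_rfl))

theorem two_mul_lt {lam σ : Ordinal.{0}} (hl : Order.IsSuccLimit lam) (h : σ < lam) :
    2 * σ < lam := by
  have := mul_lt_mul_of_pos_left h (show (0 : Ordinal.{0}) < 2 by norm_num)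
  rwa [two_mul_limit hl] at this

theorem add_one_lt_limit {lam σ : Ordinal.{0}} (hl : Order.IsSuccLimit lam) (h : σ < lam) :
    σ + 1 < lam := by
  rw [← Order.succ_eq_add_one]; exact hl.succ_lt h

/-- The key liminf lemma. -/
theorem liminf_transfer {lam : Ordinal.{0}} (hl : Order.IsSuccLimit lam)
    {f p q : Ordinal.{0} → Ordinal.{0}} (hf : Monotone f)
    (hc : ∀ l, Order.IsSuccLimit l → ∀ y < f l, ∃ x < l, y < f x)
    (h0 : ∀ σ < lam, q (2 * σ) = f (p σ))
    (h1 : ∀ σ < lam, min (f (p σ)) (f (p (σ + 1))) ≤ q (2 * σ + 1)) :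
    liminfAt lam q = f (liminfAt lam p) := by
  apply eq_of_forall_lt_iff
  intro y
  constructor
  · intro h
    obtain ⟨γ, hγ, h⟩ := lt_liminfAt.1 h
    obtain ⟨σ, a, b, c⟩ := exists_le_liminfAt p hγ
    have := h (2 * σ) (a.trans (le_two_mul σ)) (two_mul_lt hl b)
    rw [h0 σ b] at this
    exact this.trans_le (hf c)
  · intro h
    have key : ∃ γ < lam, ∀ i, γ ≤ i → i < lam → y < f (p i) := by
      rcases ord_cases (liminfAt lam p) with h2 | ⟨z, h2⟩ | h2
      · refine ⟨0, hl.bot_lt, fun i _ _ => h.trans_le (hf ?_)⟩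
        rw [h2]; exact zero_le
      · have : z < liminfAt lam p := by rw [h2]; exact Order.lt_add_one_iff.2 le_rfl
        obtain ⟨γ, hγ, h3⟩ := lt_liminfAt.1 this
        refine ⟨γ, hγ, fun i a b => h.trans_le (hf ?_)⟩
        rw [h2]; exact Order.add_one_le_of_lt (h3 i a b)
      · obtain ⟨x, hx, hy⟩ := hc _ h2 y h
        obtain ⟨γ, hγ, h3⟩ := lt_liminfAt.1 hx
        exact ⟨γ, hγ, fun i a b => hy.trans_le (hf (h3 i a b).le)⟩
    obtain ⟨γ, hγ, h3⟩ := key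
    refine lt_liminfAt.2 ⟨2 * γ, two_mul_lt hl hγ, fun j a b => ?_⟩
    obtain ⟨σ, rfl | rfl⟩ := half_cases j
    · have hs : σ < lam := (le_two_mul σ).trans_lt b
      rw [h0 σ hs]
      exact h3 σ (half_le (a.trans le_self_add)) hs
    · have hs : σ < lam := ((le_two_mul σ).trans le_self_add).trans_lt b
      have hg := half_le a
      exact (lt_min (h3 σ hg hs) (h3 (σ + 1) (hg.trans le_self_add)
        (add_one_lt_limit hl hs))).trans_le (h1 σ hs)

theorem boolLiminf_transfer {lam : Ordinal.{0}} (hl : Order.IsSuccLimit lam)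
    {p q : Ordinal.{0} → Bool}
    (h0 : ∀ σ < lam, q (2 * σ) = p σ)
    (h1 : ∀ σ < lam, q (2 * σ + 1) = p (σ + 1)) :
    boolLiminfAt lam q = boolLiminfAt lam p := by
  rw [Bool.eq_iff_iff, boolLiminfAt_true, boolLiminfAt_true]
  constructor
  · rintro ⟨γ, hγ, h⟩
    refine ⟨γ, hγ, fun σ a b => ?_⟩
    rw [← h0 σ b]
    exact h _ (a.trans (le_two_mul σ)) (two_mul_lt hl b)
  · rintro ⟨γ, hγ, h3⟩
    refine ⟨2 * γ, two_mul_lt hl hγ, fun j a b => ?_⟩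
    obtain ⟨σ, rfl | rfl⟩ := half_cases j
    · have hs : σ < lam := (le_two_mul σ).trans_lt b
      rw [h0 σ hs]
      exact h3 σ (half_le (a.trans le_self_add)) hs
    · have hs : σ < lam := ((le_two_mul σ).trans le_self_add).trans_lt b
      rw [h1 σ hs]
      exact h3 _ ((half_le a).trans le_self_add) (add_one_lt_limit hl hs)

/-! ### Running -/

namespace OTMProgram

theorem run_zero (P : OTMProgram) : P.run 0 = P.initConfig := by
  unfold run; rw [Ordinal.limitRecOn_zero]

theorem run_succ (P : OTMProgram) (τ : Ordinal.{0}) :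
    P.run (τ + 1) = P.stepConfig (P.run τ) := by
  unfold run; rw [Ordinal.limitRecOn_add_one]

theorem run_limit (P : OTMProgram) {lam : Ordinal.{0}} (h : Order.IsSuccLimit lam) :
    P.run lam = P.limitConfig lam (fun β _ => P.run β) := by
  unfold run; rw [Ordinal.limitRecOn_limit _ _ _ _ h]

theorem run_limit_head (P : OTMProgram) {lam : Ordinal.{0}} (h : Order.IsSuccLimit lam)
    (t : Fin P.tapes) : (P.run lam).head t = liminfAt lam (fun i => (P.run i).head t) := by
  rw [run_limit P h]
  exact liminfAt_congr (fun i hi => by rw [dif_pos hi])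

theorem boolLiminfAt_congr {lam : Ordinal.{0}} {p q : Ordinal.{0} → Bool}
    (h : ∀ i < lam, p i = q i) : boolLiminfAt lam p = boolLiminfAt lam q := by
  rw [Bool.eq_iff_iff, boolLiminfAt_true, boolLiminfAt_true]
  constructor
  · rintro ⟨γ, h1, h2⟩
    exact ⟨γ, h1, fun i a b => by rw [← h i b]; exact h2 i a b⟩
  · rintro ⟨γ, h1, h2⟩
    exact ⟨γ, h1, fun i a b => by rw [h i b]; exact h2 i a b⟩

theorem run_limit_tape (P : OTMProgram) {lam : Ordinal.{0}} (h : Order.IsSuccLimit lam)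
    (t : Fin P.tapes) (x : Ordinal.{0}) :
    (P.run lam).tape t x = boolLiminfAt lam (fun i => (P.run i).tape t x) := by
  rw [run_limit P h]
  exact boolLiminfAt_congr (fun i hi => by rw [dif_pos hi])

theorem run_limit_state (P : OTMProgram) {lam : Ordinal.{0}} (h : Order.IsSuccLimit lam) :
    (((P.run lam).state : ℕ) : Ordinal.{0}) =
      liminfAt lam (fun i => (((P.run i).state : ℕ) : Ordinal.{0})) := by
  have e : liminfAt lam (fun i => (((if h : i < lam then ((P.run i).state : ℕ) else 0) : ℕ) :
      Ordinal.{0})) = liminfAt lam (fun i => (((P.run i).state : ℕ) : Ordinal.{0})) :=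
    liminfAt_congr (fun i hi => by rw [dif_pos hi])
  obtain ⟨n, hn, hlt⟩ : ∃ n : ℕ, liminfAt lam (fun i => (((P.run i).state : ℕ) : Ordinal.{0})) = n ∧
      n < P.states + 1 := by
    have hle : liminfAt lam (fun i => (((P.run i).state : ℕ) : Ordinal.{0})) <
        ((P.states + 1 : ℕ) : Ordinal.{0}) := by
      by_contra hc
      push Not at hc
      have h2 : ((P.states : ℕ) : Ordinal.{0}) <
        liminfAt lam (fun i => (((P.run i).state : ℕ) : Ordinal.{0})) :=
        lt_of_lt_of_le (by exact_mod_cast Nat.lt_succ_self _) hc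
      obtain ⟨γ, hγ, h3⟩ := lt_liminfAt.1 h2
      have h4 := h3 γ le_rfl hγ
      have h5 : P.states < ((P.run γ).state : ℕ) := by exact_mod_cast h4
      have := (P.run γ).state.isLt
      omega
    obtain ⟨n, hn⟩ := Ordinal.lt_omega0.1 (hle.trans (Ordinal.natCast_lt_omega0 _))
    refine ⟨n, hn, ?_⟩
    rw [hn] at hle
    exact_mod_cast hle
  rw [hn]
  congr 1
  rw [run_limit P h]
  show natLiminfAt lam _ % (P.states + 1) = n
  unfold natLiminfAt
  rw [e, hn]
  simp only [Ordinal.card_nat, Cardinal.toNat_natCast]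
  exact Nat.mod_eq_of_lt hlt

end OTMProgram

/-! ### Positions, classes, tracks -/

namespace Speed

/-- the finite part of an ordinal -/
def nn (x : Ordinal.{0}) : ℕ := (x % ω).card.toNat

theorem div_form (a : Ordinal.{0}) (n : ℕ) : (ω * a + n) / ω = a := by
  rw [Ordinal.mul_add_div _ Ordinal.omega0_ne_zero,
    Ordinal.div_eq_zero_of_lt (Ordinal.natCast_lt_omega0 n), add_zero]

theorem nn_form (a : Ordinal.{0}) (n : ℕ) : nn (ω * a + n) = n := by
  unfold nn
  rw [Ordinal.mul_add_mod_self, Ordinal.mod_eq_of_lt (Ordinal.natCast_lt_omega0 n)]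
  simp

theorem form (x : Ordinal.{0}) : ∃ (a : Ordinal.{0}) (n : ℕ), x = ω * a + n := by
  obtain ⟨n, hn⟩ := Ordinal.lt_omega0.1 (Ordinal.mod_lt x Ordinal.omega0_ne_zero)
  exact ⟨x / ω, n, by rw [← hn, Ordinal.div_add_mod]⟩

theorem form_inj {a a' : Ordinal.{0}} {n n' : ℕ} (h : ω * a + n = ω * a' + n') :
    a = a' ∧ n = n' := by
  constructor
  · rw [← div_form a n, h, div_form]
  · rw [← nn_form a n, h, nn_form]

theorem form_succ (a : Ordinal.{0}) (n : ℕ) : ω * a + n + 1 = ω * a + ((n + 1 : ℕ) : Ordinal.{0}) := by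
  rw [add_assoc]; norm_cast

theorem form_left (a : Ordinal.{0}) (n : ℕ) :
    leftOf (ω * a + ((n + 1 : ℕ) : Ordinal.{0})) = ω * a + n := by
  rw [← form_succ, leftOf_add_one]

theorem form_limit {a : Ordinal.{0}} (h : a ≠ 0) :
    Order.IsSuccLimit (ω * a + ((0 : ℕ) : Ordinal.{0})) := by
  rw [Nat.cast_zero, add_zero]
  exact Ordinal.isSuccLimit_mul_left Ordinal.isSuccLimit_omega0 (pos_iff_ne_zero.2 h)

theorem form_left0 (a : Ordinal.{0}) : leftOf (ω * a + ((0 : ℕ) : Ordinal.{0})) = 0 := by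
  by_cases h : a = 0
  · subst h; simp [leftOf_zero]
  · exact leftOf_limit (form_limit h)

theorem form_lt {a a' : Ordinal.{0}} (h : a < a') (n : ℕ) : ω * a + n < ω * a' :=
  calc ω * a + n < ω * a + ω := by
        gcongr; exact Ordinal.natCast_lt_omega0 n
    _ = ω * (a + 1) := by rw [mul_add, mul_one]
    _ ≤ ω * a' := mul_le_mul_right (Order.add_one_le_of_lt h) ω

theorem form_le {a a' : Ordinal.{0}} {n n' : ℕ} (h : ω * a + n ≤ ω * a' + n') :
    a < a' ∨ (a = a' ∧ n ≤ n') := by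
  rcases lt_trichotomy a a' with h1 | h1 | h1
  · exact Or.inl h1
  · subst h1
    right
    refine ⟨rfl, ?_⟩
    have := (add_le_add_iff_left (ω * a)).1 h
    exact_mod_cast this
  · exact absurd h (not_le.2 ((form_lt h1 n').trans_le le_self_add))

/-- position function induced by a function on the finite part -/
def psi (g : ℕ → ℕ) (x : Ordinal.{0}) : Ordinal.{0} := ω * (x / ω) + (g (nn x) : ℕ)

theorem psi_form (g : ℕ → ℕ) (a : Ordinal.{0}) (n : ℕ) : psi g (ω * a + n) = ω * a + (g n : ℕ) := by
  unfold psi; rw [div_form, nn_form]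

structure GoodG (g : ℕ → ℕ) : Prop where
  zero : g 0 = 0
  step : ∀ n, g (n + 1) = g n ∨ g (n + 1) = g n + 2
  unb : ∀ N, ∃ n, N < g n

theorem GoodG.mono {g : ℕ → ℕ} (h : GoodG g) : Monotone g :=
  monotone_nat_of_le_succ (fun n => by rcases h.step n with h | h <;> omega)

theorem psi_mono {g : ℕ → ℕ} (h : GoodG g) : Monotone (psi g) := by
  intro x y hxy
  obtain ⟨a, n, rfl⟩ := form x
  obtain ⟨b, k, rfl⟩ := form y
  rw [psi_form, psi_form]
  rcases form_le hxy with h1 | ⟨rfl, h1⟩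
  · exact (form_lt h1 _).le.trans le_self_add
  · gcongr; exact h.mono h1

theorem psi_cont {g : ℕ → ℕ} (h : GoodG g) :
    ∀ l, Order.IsSuccLimit l → ∀ y < psi g l, ∃ x < l, y < psi g x := by
  intro l hl y hy
  obtain ⟨a, n, rfl⟩ := form l
  rcases n with _ | n
  · rw [psi_form, h.zero] at hy
    obtain ⟨b, k, rfl⟩ := form y
    obtain ⟨n, hn⟩ := h.unb k
    refine ⟨ω * b + n, ?_, ?_⟩
    · have hb : b < a := by
        rcases form_le hy.le with h1 | ⟨rfl, h1⟩
        · exact h1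
        · have : k = 0 := by omega
          subst this
          exact absurd hy (lt_irrefl _)
      exact (form_lt hb n).trans_le le_self_add
    · rw [psi_form]
      gcongr
  · rw [← form_succ, ← Order.succ_eq_add_one] at hl
    exact absurd hl (Order.not_isSuccLimit_succ _)

theorem psi_succ {g : ℕ → ℕ} (h : GoodG g) (x : Ordinal.{0}) :
    psi g (x + 1) = psi g x ∨ psi g (x + 1) = psi g x + 1 + 1 := by
  obtain ⟨a, n, rfl⟩ := form x
  rw [form_succ, psi_form, psi_form]
  rcases h.step n with h | h
  · left; rw [h]
  · right; rw [h, form_succ, form_succ]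

theorem psi_left {g : ℕ → ℕ} (h : GoodG g) (x : Ordinal.{0}) :
    psi g (leftOf x) = psi g x ∨ psi g (leftOf x) = leftOf (leftOf (psi g x)) := by
  obtain ⟨a, n, rfl⟩ := form x
  rcases n with _ | n
  · right
    rw [form_left0, psi_form, h.zero, form_left0, leftOf_zero]
    have := psi_form g 0 0
    simpa [h.zero] using this
  · rw [form_left, psi_form, psi_form]
    rcases h.step n with h | h
    · left; rw [h]
    · right; rw [h, form_left, form_left]

variable {m : ℕ}

/-- truncated finite part -/
def cc (m n : ℕ) : ℕ := if n < 4 * m then n else 4 * m + n % (4 * m)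

theorem cc_lt (hm : 0 < m) (n : ℕ) : cc m n < 8 * m := by
  unfold cc
  have := Nat.mod_lt n (show 4 * m > 0 by omega)
  split_ifs <;> omega

theorem cc_mod (n : ℕ) : cc m n % (4 * m) = n % (4 * m) := by
  unfold cc
  split_ifs
  · rfl
  · simp

theorem cc_congr_mod {n k : ℕ} (h : cc m n = cc m k) : n % (4 * m) = k % (4 * m) := by
  rw [← cc_mod, h, cc_mod]

theorem cc_congr_lt {n k : ℕ} (h : cc m n = cc m k) (hn : n < 4 * m) : k = n := by
  unfold cc at h
  rw [if_pos hn] at h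
  split_ifs at h <;> omega

theorem cc_succ {n k : ℕ} (h : cc m n = cc m k) : cc m (n + 1) = cc m (k + 1) := by
  by_cases hn : n < 4 * m
  · rw [cc_congr_lt h hn]
  · have hk : ¬ k < 4 * m := fun hk => hn (by rw [cc_congr_lt h.symm hk]; exact hk)
    unfold cc
    rw [if_neg (by omega), if_neg (by omega), Nat.add_mod, cc_congr_mod h, ← Nat.add_mod]

/-- classes of positions -/
abbrev Cl (m : ℕ) := Bool × Fin (8 * m + 1)

open scoped Classical in
def cls (m : ℕ) (x : Ordinal.{0}) : Cl m := (decide (x / ω = 0), Fin.ofNat _ (cc m (nn x)))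

theorem cls_eq_iff (hm : 0 < m) {a b : Ordinal.{0}} {n k : ℕ} :
    cls m (ω * a + n) = cls m (ω * b + k) ↔ ((a = 0 ↔ b = 0) ∧ cc m n = cc m k) := by
  unfold cls
  rw [div_form, div_form, nn_form, nn_form, Prod.mk.injEq, decide_eq_decide]
  have h1 := cc_lt hm n
  have h2 := cc_lt hm k
  refine and_congr Iff.rfl ⟨fun h => ?_, fun h => by rw [h]⟩
  have := congrArg Fin.val h
  simp only [Fin.val_ofNat] at this
  rwa [Nat.mod_eq_of_lt (by omega), Nat.mod_eq_of_lt (by omega)] at this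

theorem cls_succ (hm : 0 < m) {x y : Ordinal.{0}} (h : cls m x = cls m y) :
    cls m (x + 1) = cls m (y + 1) := by
  obtain ⟨a, n, rfl⟩ := form x
  obtain ⟨b, k, rfl⟩ := form y
  rw [form_succ, form_succ, cls_eq_iff hm]
  rw [cls_eq_iff hm] at h
  exact ⟨h.1, cc_succ h.2⟩

theorem cls_limit (hm : 0 < m) {x y : Ordinal.{0}} (hx : Order.IsSuccLimit x)
    (hy : Order.IsSuccLimit y) : cls m x = cls m y := by
  have key : ∀ {x : Ordinal.{0}}, Order.IsSuccLimit x → ∃ a, a ≠ 0 ∧ x = ω * a + (0 : ℕ) := by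
    intro x hx
    obtain ⟨a, n, rfl⟩ := form x
    rcases n with _ | n
    · refine ⟨a, ?_, rfl⟩
      rintro rfl
      exact hx.ne_bot (by simp)
    · rw [← form_succ, ← Order.succ_eq_add_one] at hx
      exact absurd hx (Order.not_isSuccLimit_succ _)
  obtain ⟨a, ha, rfl⟩ := key hx
  obtain ⟨b, hb, rfl⟩ := key hy
  rw [cls_eq_iff hm]
  simp [ha, hb]

/-- kinds of tracks -/
inductive Kd (m : ℕ) where
  | X (v : Cl m) : Kd m
  | M : Kd m
  | B (b : Bool) (j : Fin (4 * m)) : Kd m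
  | Z (j : Fin m) : Kd m

instance : Finite (Kd m) := by
  let f : Kd m → (Cl m ⊕ Unit) ⊕ ((Bool × Fin (4 * m)) ⊕ Fin m) := fun k =>
    match k with
    | .X v => Sum.inl (Sum.inl v)
    | .M => Sum.inl (Sum.inr ())
    | .B b j => Sum.inr (Sum.inl (b, j))
    | .Z j => Sum.inr (Sum.inr j)
  apply Finite.of_injective f
  intro a b h
  cases a <;> cases b <;> simp_all [f]

def off (m : ℕ) (b : Bool) : ℕ := if b then 2 * m else 0

def gB (m : ℕ) (b : Bool) (n : ℕ) : ℕ := 2 * ((n + off m b) / (4 * m))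

theorem good_two : GoodG (fun n => 2 * n) := ⟨rfl, fun n => by right; ring, fun N => ⟨N + 1, by omega⟩⟩

theorem good_gB (hm : 0 < m) (b : Bool) : GoodG (gB m b) := by
  refine ⟨?_, fun n => ?_, fun N => ?_⟩
  · unfold gB off
    rw [Nat.div_eq_of_lt]
    split_ifs <;> omega
  · unfold gB
    have := Nat.succ_div (a := n + off m b) (b := 4 * m)
    rw [show n + 1 + off m b = n + off m b + 1 by ring, this]
    split_ifs <;> omega
  · refine ⟨4 * m * (N + 1), ?_⟩
    unfold gB
    rw [Nat.mul_add_div (by omega)]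
    have := Nat.zero_le (off m b / (4 * m))
    generalize off m b / (4 * m) = q at *
    omega

theorem gB_stay (hm : 0 < m) (b : Bool) {n k : ℕ} (h : n % (4 * m) = k % (4 * m)) :
    gB m b (n + 1) = gB m b n ↔ gB m b (k + 1) = gB m b k := by
  unfold gB
  have e1 := Nat.succ_div (a := n + off m b) (b := 4 * m)
  have e2 := Nat.succ_div (a := k + off m b) (b := 4 * m)
  have e3 : 4 * m ∣ n + off m b + 1 ↔ 4 * m ∣ k + off m b + 1 := by
    rw [Nat.dvd_iff_mod_eq_zero, Nat.dvd_iff_mod_eq_zero, add_assoc, add_assoc, Nat.add_mod, h,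
      ← Nat.add_mod]
  rw [show n + 1 + off m b = n + off m b + 1 by ring,
    show k + 1 + off m b = k + off m b + 1 by ring, e1, e2]
  by_cases h4 : 4 * m ∣ n + off m b + 1
  · rw [if_pos h4, if_pos (e3.1 h4)]; omega
  · rw [if_neg h4, if_neg (fun h => h4 (e3.2 h))]; omega

def pos : Kd m → Ordinal.{0} → Ordinal.{0}
  | .X _ => psi (fun n => 2 * n)
  | .M => psi (fun n => 2 * n)
  | .B b _ => psi (gB m b)
  | .Z _ => fun _ => 0

def sel : Kd m → Ordinal.{0} → Prop
  | .X _ => fun _ => True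
  | .M => fun _ => True
  | .B b j => fun x => (nn x + off m b) % (4 * m) = j
  | .Z j => fun x => x = ((j : ℕ) : Ordinal.{0})

theorem pos_mono (hm : 0 < m) (k : Kd m) : Monotone (pos k) := by
  cases k
  · exact psi_mono good_two
  · exact psi_mono good_two
  · exact psi_mono (good_gB hm _)
  · exact fun _ _ _ => le_rfl

theorem pos_cont (hm : 0 < m) (k : Kd m) :
    ∀ l, Order.IsSuccLimit l → ∀ y < pos k l, ∃ x < l, y < pos k x := by
  cases k
  · exact psi_cont good_two
  · exact psi_cont good_two
  · exact psi_cont (good_gB hm _)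
  · exact fun l hl y hy => ⟨0, hl.bot_lt, hy⟩

theorem pos_succ (hm : 0 < m) (k : Kd m) (x : Ordinal.{0}) :
    pos k (x + 1) = pos k x ∨ pos k (x + 1) = pos k x + 1 + 1 := by
  cases k
  · exact psi_succ good_two x
  · exact psi_succ good_two x
  · exact psi_succ (good_gB hm _) x
  · exact Or.inl rfl

theorem pos_left (hm : 0 < m) (k : Kd m) (x : Ordinal.{0}) :
    pos k (leftOf x) = pos k x ∨ pos k (leftOf x) = leftOf (leftOf (pos k x)) := by
  cases k
  · exact psi_left good_two x
  · exact psi_left good_two x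
  · exact psi_left (good_gB hm _) x
  · exact Or.inl rfl

theorem pos_zero (hm : 0 < m) (k : Kd m) : pos k 0 = 0 := by
  have key : ∀ g, GoodG g → psi g 0 = 0 := by
    intro g h
    have := psi_form g 0 0
    simpa [h.zero] using this
  cases k
  · exact key _ good_two
  · exact key _ good_two
  · exact key _ (good_gB hm _)
  · rfl

theorem stayR_congr (hm : 0 < m) (k : Kd m) {x y : Ordinal.{0}} (h : cls m x = cls m y) :
    pos k (x + 1) = pos k x ↔ pos k (y + 1) = pos k y := by
  obtain ⟨a, n, rfl⟩ := form x
  obtain ⟨b, i, rfl⟩ := form y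
  rw [cls_eq_iff hm] at h
  have key : ∀ g : ℕ → ℕ, (g (n + 1) = g n ↔ g (i + 1) = g i) →
      (psi g (ω * a + n + 1) = psi g (ω * a + n) ↔ psi g (ω * b + i + 1) = psi g (ω * b + i)) := by
    intro g hg
    rw [form_succ, form_succ, psi_form, psi_form, psi_form, psi_form]
    constructor
    · intro h
      rw [hg.1 (form_inj h).2]
    · intro h
      rw [hg.2 (form_inj h).2]
  cases k
  · exact key _ (by constructor <;> intro h <;> omega)
  · exact key _ (by constructor <;> intro h <;> omega)
  · exact key _ (gB_stay hm _ (cc_congr_mod h.2))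
  · exact iff_of_true rfl rfl

theorem stayL_congr (hm : 0 < m) (k : Kd m) {x y : Ordinal.{0}} (h : cls m x = cls m y) :
    pos k (leftOf x) = pos k x ↔ pos k (leftOf y) = pos k y := by
  obtain ⟨a, n, rfl⟩ := form x
  obtain ⟨b, i, rfl⟩ := form y
  rw [cls_eq_iff hm] at h
  have key : ∀ g : ℕ → ℕ, GoodG g →
      (∀ n i, cc m (n + 1) = cc m (i + 1) → (g (n + 1) = g n ↔ g (i + 1) = g i)) →
      (psi g (leftOf (ω * a + n)) = psi g (ω * a + n) ↔
        psi g (leftOf (ω * b + i)) = psi g (ω * b + i)) := by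
    intro g hgood hg
    have z : psi g 0 = ω * (0 : Ordinal.{0}) + ((0 : ℕ) : Ordinal.{0}) := by
      have := psi_form g 0 0
      simpa [hgood.zero] using this
    by_cases hn : n = 0
    · have hi : i = 0 := by rw [cc_congr_lt h.2 (by omega), hn]
      subst hn; subst hi
      rw [form_left0, form_left0, psi_form, psi_form, hgood.zero, z]
      constructor
      · intro h'
        rw [h.1.1 (form_inj h').1.symm]
      · intro h'
        rw [h.1.2 (form_inj h').1.symm]
    · have hi : i ≠ 0 := fun hi => hn (by rw [cc_congr_lt h.2.symm (by omega), hi])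
      obtain ⟨n, rfl⟩ := Nat.exists_eq_succ_of_ne_zero hn
      obtain ⟨i, rfl⟩ := Nat.exists_eq_succ_of_ne_zero hi
      rw [form_left, form_left, psi_form, psi_form, psi_form, psi_form]
      constructor
      · intro h'
        rw [(hg n i h.2).1 (form_inj h').2.symm]
      · intro h'
        rw [(hg n i h.2).2 (form_inj h').2.symm]
  cases k
  · exact key _ good_two (fun _ _ _ => by constructor <;> intro h <;> omega)
  · exact key _ good_two (fun _ _ _ => by constructor <;> intro h <;> omega)
  · refine key _ (good_gB hm _) (fun n i h => gB_stay hm _ ?_)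
    have := cc_congr_mod h
    exact Nat.ModEq.add_right_cancel' 1 this
  · exact iff_of_true rfl rfl

theorem sel_congr (hm : 0 < m) (k : Kd m) {x y : Ordinal.{0}} (h : cls m x = cls m y) :
    sel k x ↔ sel k y := by
  obtain ⟨a, n, rfl⟩ := form x
  obtain ⟨b, i, rfl⟩ := form y
  rw [cls_eq_iff hm] at h
  cases k with
  | X v => exact Iff.rfl
  | M => exact Iff.rfl
  | B c j =>
    show (nn _ + off m c) % (4 * m) = j ↔ (nn _ + off m c) % (4 * m) = j
    rw [nn_form, nn_form, Nat.add_mod, cc_congr_mod h.2, ← Nat.add_mod]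
  | Z j =>
    show ω * a + n = ((j : ℕ) : Ordinal.{0}) ↔ ω * b + i = ((j : ℕ) : Ordinal.{0})
    have key : ∀ (a : Ordinal.{0}) (n : ℕ), ω * a + n = ((j : ℕ) : Ordinal.{0}) ↔ a = 0 ∧ n = j := by
      intro a n
      constructor
      · intro h
        have : ω * a + n = ω * 0 + ((j : ℕ) : Ordinal.{0}) := by rw [h]; simp
        exact form_inj this
      · rintro ⟨rfl, rfl⟩; simp
    rw [key, key, h.1]
    have := j.isLt
    constructor
    · rintro ⟨h1, h2⟩
      exact ⟨h1, by rw [cc_congr_lt h.2 (by omega), h2]⟩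
    · rintro ⟨h1, h2⟩
      exact ⟨h1, by rw [cc_congr_lt h.2.symm (by omega), h2]⟩

theorem sel_inj (hm : 0 < m) (k : Kd m) {x y : Ordinal.{0}} (hx : sel k x) (hy : sel k y)
    (h : pos k x = pos k y) : x = y := by
  obtain ⟨a, n, rfl⟩ := form x
  obtain ⟨b, i, rfl⟩ := form y
  have key : ∀ g : ℕ → ℕ, psi g (ω * a + n) = psi g (ω * b + i) →
      (g n = g i → n = i) → ω * a + n = ω * b + i := by
    intro g hg hh
    rw [psi_form, psi_form] at hg
    obtain ⟨h1, h2⟩ := form_inj hg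
    rw [hh h2, h1]
  cases k with
  | X v => exact key _ h (fun h => by simpa using h)
  | M => exact key _ h (fun h => by simpa using h)
  | B c j =>
    refine key _ h (fun h => ?_)
    have hx : (nn _ + off m c) % (4 * m) = j := hx
    have hy : (nn _ + off m c) % (4 * m) = j := hy
    rw [nn_form] at hx hy
    unfold gB at h
    have h1 := Nat.div_add_mod (n + off m c) (4 * m)
    have h2 := Nat.div_add_mod (i + off m c) (4 * m)
    rw [hx] at h1
    rw [hy] at h2
    have h3 : (n + off m c) / (4 * m) = (i + off m c) / (4 * m) := by omega
    rw [h3] at h1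
    omega
  | Z j => exact Eq.trans hx (Eq.symm hy)

end Speed

/-! ### Local equivalence of configurations -/

namespace Speed

/-- `R` holds along all walks of length at most `k`. -/
def Good (R : Ordinal.{0} → Ordinal.{0} → Prop) : ℕ → Ordinal.{0} → Ordinal.{0} → Prop
  | 0, x, y => R x y
  | k + 1, x, y => R x y ∧ Good R k (x + 1) (y + 1) ∧ Good R k (leftOf x) (leftOf y)

theorem Good.base {R : Ordinal.{0} → Ordinal.{0} → Prop} {k : ℕ} {x y : Ordinal.{0}}
    (h : Good R k x y) : R x y := by
  cases k with
  | zero => exact h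
  | succ k => exact h.1

theorem Good.pred {R : Ordinal.{0} → Ordinal.{0} → Prop} {k : ℕ} : ∀ {x y : Ordinal.{0}},
    Good R (k + 1) x y → Good R k x y := by
  induction k with
  | zero => intro x y h; exact h.1
  | succ k ih => intro x y h; exact ⟨h.1, ih h.2.1, ih h.2.2⟩

def LEq (P : OTMProgram) (k : ℕ) (c c' : OTMConfig P) : Prop :=
  c.state = c'.state ∧ ∀ t, ∃ R : Ordinal.{0} → Ordinal.{0} → Prop,
    (∀ x y x' y', R x x' → R y y' → (x = y ↔ x' = y')) ∧
    (∀ x x', R x x' → c.tape t x = c'.tape t x') ∧ Good R k (c.head t) (c'.head t)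

def Halted (P : OTMProgram) (c : OTMConfig P) : Prop := P.trans c.state (P.readSymbols c) = none

theorem LEq.read {P : OTMProgram} {k : ℕ} {c c' : OTMConfig P} (h : LEq P k c c') :
    P.trans c.state (P.readSymbols c) = P.trans c'.state (P.readSymbols c') := by
  have : P.readSymbols c = P.readSymbols c' := by
    funext t
    obtain ⟨R, _, h2, h3⟩ := h.2 t
    exact h2 _ _ h3.base
  rw [h.1, this]

theorem LEq.step {P : OTMProgram} {k : ℕ} {c c' : OTMConfig P} (h : LEq P (k + 1) c c') :
    LEq P k (P.stepConfig c) (P.stepConfig c') := by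
  have e := h.read
  unfold OTMProgram.stepConfig
  rw [← e]
  cases P.trans c.state (P.readSymbols c) with
  | none =>
    refine ⟨h.1, fun t => ?_⟩
    obtain ⟨R, h1, h2, h3⟩ := h.2 t
    exact ⟨R, h1, h2, h3.pred⟩
  | some r =>
    obtain ⟨s', w, mv⟩ := r
    refine ⟨rfl, fun t => ?_⟩
    obtain ⟨R, h1, h2, h3⟩ := h.2 t
    refine ⟨R, h1, fun x x' hx => ?_, ?_⟩
    · have := h1 _ _ _ _ hx h3.base
      show (if x = c.head t then w t else c.tape t x) =
        (if x' = c'.head t then w t else c'.tape t x')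
      by_cases hh : x = c.head t
      · rw [if_pos hh, if_pos (this.1 hh)]
      · rw [if_neg hh, if_neg (fun h => hh (this.2 h)), h2 _ _ hx]
    · show Good R k (if mv t then c.head t + 1 else leftOf (c.head t))
        (if mv t then c'.head t + 1 else leftOf (c'.head t))
      cases mv t
      · exact h3.2.2
      · exact h3.2.1

theorem LEq.halted {P : OTMProgram} {k : ℕ} : ∀ {c c' : OTMConfig P}, LEq P k c c' →
    (Halted P (P.stepConfig^[k] c) ↔ Halted P (P.stepConfig^[k] c')) := by
  induction k with
  | zero =>
    intro c c' h
    simp only [Function.iterate_zero, id]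
    unfold Halted
    rw [h.read]
  | succ k ih =>
    intro c c' h
    rw [Function.iterate_succ_apply, Function.iterate_succ_apply]
    exact ih h.step

/-- chart near a position far from limits -/
theorem good_far {m : ℕ} (a b : Ordinal.{0}) (u v : ℕ) : ∀ (k i : ℕ), k ≤ i → i + k < 2 * m →
    Good (fun x x' => ∃ i < 2 * m, x = ω * a + ((u + i : ℕ) : Ordinal.{0}) ∧
      x' = ω * b + ((v + i : ℕ) : Ordinal.{0})) k (ω * a + ((u + i : ℕ) : Ordinal.{0}))
      (ω * b + ((v + i : ℕ) : Ordinal.{0})) := by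
  intro k
  induction k with
  | zero => intro i _ h2; exact ⟨i, by omega, rfl, rfl⟩
  | succ k ih =>
    intro i h1 h2
    refine ⟨⟨i, by omega, rfl, rfl⟩, ?_, ?_⟩
    · rw [form_succ, form_succ, add_assoc, add_assoc]
      exact ih (i + 1) (by omega) (by omega)
    · obtain ⟨i, rfl⟩ : ∃ j, i = j + 1 := ⟨i - 1, by omega⟩
      rw [← add_assoc, ← add_assoc, form_left, form_left]
      exact ih i (by omega) (by omega)

def nearR (m : ℕ) (a b : Ordinal.{0}) (x x' : Ordinal.{0}) : Prop :=
  (∃ j < m, x = ω * 0 + ((j : ℕ) : Ordinal.{0}) ∧ x' = ω * 0 + ((j : ℕ) : Ordinal.{0})) ∨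
    (∃ i < 2 * m, x = ω * a + ((i : ℕ) : Ordinal.{0}) ∧ x' = ω * b + ((i : ℕ) : Ordinal.{0}))

theorem good_near0 {m : ℕ} (a b : Ordinal.{0}) : ∀ (k j : ℕ), j + k < m →
    Good (nearR m a b) k (ω * 0 + ((j : ℕ) : Ordinal.{0})) (ω * 0 + ((j : ℕ) : Ordinal.{0})) := by
  intro k
  induction k with
  | zero => intro j h; exact Or.inl ⟨j, by omega, rfl, rfl⟩
  | succ k ih =>
    intro j h
    refine ⟨Or.inl ⟨j, by omega, rfl, rfl⟩, ?_, ?_⟩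
    · rw [form_succ]; exact ih (j + 1) (by omega)
    · rcases j with _ | j
      · rw [form_left0]
        have := ih 0 (by omega)
        simpa using this
      · rw [form_left]; exact ih j (by omega)

theorem good_near {m : ℕ} (a b : Ordinal.{0}) : ∀ (k i : ℕ), k < m + 1 → i + k < 2 * m →
    Good (nearR m a b) k (ω * a + ((i : ℕ) : Ordinal.{0})) (ω * b + ((i : ℕ) : Ordinal.{0})) := by
  intro k
  induction k with
  | zero => intro i _ h; exact Or.inr ⟨i, by omega, rfl, rfl⟩
  | succ k ih =>
    intro i h0 h
    refine ⟨Or.inr ⟨i, by omega, rfl, rfl⟩, ?_, ?_⟩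
    · rw [form_succ, form_succ]; exact ih (i + 1) (by omega) (by omega)
    · rcases i with _ | i
      · rw [form_left0, form_left0]
        have := good_near0 (m := m) a b k 0 (by omega)
        simpa using this
      · rw [form_left, form_left]; exact ih i (by omega) (by omega)

/-- the contents `ρ` read by the tracks are compatible with head position `p` and tape `T` -/
def Compat {m : ℕ} (ρ : Kd m → Bool) (p : Ordinal.{0}) (T : Ordinal.{0} → Bool) : Prop :=
  ∀ k x, (∀ v, k ≠ Kd.X v) → sel k x → pos k x = pos k p → T x = ρ k

theorem compat_B {m : ℕ} {ρ : Kd m → Bool} {a : Ordinal.{0}} {n : ℕ}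
    {T : Ordinal.{0} → Bool} (h : Compat ρ (ω * a + n) T) (c : Bool) (i : ℕ) (j : Fin (4 * m))
    (h1 : (i + off m c) % (4 * m) = j) (h2 : gB m c i = gB m c n) : T (ω * a + i) = ρ (Kd.B c j) := by
  apply h (Kd.B c j)
  · intro v hv; cases hv
  · show (nn _ + off m c) % (4 * m) = j
    rw [nn_form, h1]
  · show psi _ _ = psi _ _
    rw [psi_form, psi_form, h2]

theorem gB_eq {m : ℕ} {c : Bool} {n i : ℕ} {q : ℕ}
    (h1 : 4 * m * q ≤ n + off m c) (h2 : n + off m c < 4 * m * (q + 1))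
    (h3 : 4 * m * q ≤ i + off m c) (h4 : i + off m c < 4 * m * (q + 1)) :
    gB m c i = gB m c n := by
  unfold gB
  rw [Nat.div_eq_of_lt_le (by linarith) (by linarith) (m := n + off m c) (k := q),
    Nat.div_eq_of_lt_le (by linarith) (by linarith) (m := i + off m c) (k := q)]

theorem chart {m K : ℕ} (hK : K < m) {ρ : Kd m → Bool} {p p' : Ordinal.{0}}
    {T T' : Ordinal.{0} → Bool} (hc : cls m p = cls m p') (h : Compat ρ p T) (h' : Compat ρ p' T') :
    ∃ R : Ordinal.{0} → Ordinal.{0} → Prop,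
    (∀ x y x' y', R x x' → R y y' → (x = y ↔ x' = y')) ∧
    (∀ x x', R x x' → T x = T' x') ∧ Good R K p p' := by
  have hm : 0 < m := by omega
  obtain ⟨a, n, rfl⟩ := form p
  obtain ⟨b, n', rfl⟩ := form p'
  rw [cls_eq_iff hm] at hc
  obtain ⟨hab, hcc⟩ := hc
  by_cases hn : n < m
  · have : n' = n := cc_congr_lt hcc (by omega)
    subst this
    refine ⟨nearR m a b, ?_, ?_, good_near a b K n' (by omega) (by omega)⟩
    · rintro x y x' y' (⟨i, hi, rfl, rfl⟩ | ⟨i, hi, rfl, rfl⟩) (⟨j, hj, rfl, rfl⟩ | ⟨j, hj, rfl, rfl⟩)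
      · exact Iff.rfl
      · constructor
        · intro h; obtain ⟨e1, rfl⟩ := form_inj h; rw [← hab.1 e1.symm]
        · intro h; obtain ⟨e1, rfl⟩ := form_inj h; rw [← hab.2 e1.symm]
      · constructor
        · intro h; obtain ⟨e1, rfl⟩ := form_inj h; rw [hab.1 e1]
        · intro h; obtain ⟨e1, rfl⟩ := form_inj h; rw [hab.2 e1]
      · constructor
        · intro h; rw [(form_inj h).2]
        · intro h; rw [(form_inj h).2]
    · rintro x x' (⟨j, hj, rfl, rfl⟩ | ⟨i, hi, rfl, rfl⟩)
      · have hs : sel (Kd.Z ⟨j, hj⟩) (ω * 0 + ((j : ℕ) : Ordinal.{0})) := by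
          show ω * 0 + ((j : ℕ) : Ordinal.{0}) = ((j : ℕ) : Ordinal.{0})
          simp
        rw [h (Kd.Z ⟨j, hj⟩) _ (by intro v hv; cases hv) hs rfl,
          h' (Kd.Z ⟨j, hj⟩) _ (by intro v hv; cases hv) hs rfl]
      · have ho : off m true = 2 * m := rfl
        have h1 : (i + off m true) % (4 * m) = i + 2 * m := by
          rw [ho]; exact Nat.mod_eq_of_lt (by omega)
        have h2 : gB m true i = gB m true n' :=
          gB_eq (q := 0) (by omega) (by omega) (by omega) (by omega)
        rw [compat_B h true i ⟨i + 2 * m, by omega⟩ h1 h2, compat_B h' true i ⟨i + 2 * m, by omega⟩ h1 h2]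
  · have hn' : ¬ n' < m := fun hk => hn (by rw [cc_congr_lt hcc.symm (by omega)]; exact hk)
    have hmod := cc_congr_mod hcc
    obtain ⟨u, rfl⟩ : ∃ u, n = u + m := ⟨n - m, by omega⟩
    obtain ⟨v, rfl⟩ : ∃ u, n' = u + m := ⟨n' - m, by omega⟩
    have hmod2 : u % (4 * m) = v % (4 * m) := Nat.ModEq.add_right_cancel' m hmod
    refine ⟨_, ?_, ?_, good_far (m := m) a b u v K m (by omega) (by omega)⟩
    · rintro x y x' y' ⟨i, hi, rfl, rfl⟩ ⟨j, hj, rfl, rfl⟩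
      constructor
      · intro h
        have := (form_inj h).2
        rw [show i = j by omega]
      · intro h
        have := (form_inj h).2
        rw [show i = j by omega]
    · rintro x x' ⟨i, hi, rfl, rfl⟩
      have key : ∃ c : Bool, ∀ w, w % (4 * m) = u % (4 * m) →
          gB m c (w + i) = gB m c (w + m) := by
        have h4 : u % (4 * m) < 4 * m := Nat.mod_lt _ (by omega)
        by_cases hu : u % (4 * m) ≤ 2 * m
        · refine ⟨false, fun w hw => gB_eq (q := w / (4 * m)) ?_ ?_ ?_ ?_⟩ <;>
          · have e := Nat.div_add_mod w (4 * m)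
            have ho : off m false = 0 := rfl
            rw [ho]
            rw [hw] at e
            try rw [mul_add]
            omega
        · refine ⟨true, fun w hw => gB_eq (q := w / (4 * m) + 1) ?_ ?_ ?_ ?_⟩ <;>
          · have e := Nat.div_add_mod w (4 * m)
            have ho : off m true = 2 * m := rfl
            rw [ho]
            rw [hw] at e
            try rw [mul_add]
            try rw [mul_add]
            omega
      obtain ⟨c, hcw⟩ := key
      have hj : (u + i + off m c) % (4 * m) < 4 * m := Nat.mod_lt _ (by omega)
      rw [compat_B h c (u + i) ⟨_, hj⟩ rfl (hcw u rfl),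
        compat_B h' c (v + i) ⟨_, hj⟩ ?_ (hcw v hmod2.symm)]
      show (v + i + off m c) % (4 * m) = (u + i + off m c) % (4 * m)
      rw [add_assoc, add_assoc, Nat.add_mod, ← hmod2, ← Nat.add_mod]

end Speed

/-! ### Part 4: machines on a finite index type -/

namespace Speed

open Classical

section generic

variable {ι St : Type} [Finite ι] [Nonempty St]

/-- Build an OTM program from a transition function on finite index types. -/
def mkP (N : ℕ) (code : St → Fin (N + 1))
    (F : St → (ι → Bool) → Option (St × (ι → Bool) × (ι → Bool))) : OTMProgram where
  tapes := Nat.card ι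
  states := N
  trans := fun n ρ => (F (Function.invFun code n) (fun i => ρ (Finite.equivFin ι i))).map
    (fun r => (code r.1, fun j => r.2.1 ((Finite.equivFin ι).symm j),
      fun j => r.2.2 ((Finite.equivFin ι).symm j)))

variable (N : ℕ) (code : St → Fin (N + 1))
    (F : St → (ι → Bool) → Option (St × (ι → Bool) × (ι → Bool)))

def hd (τ : Ordinal.{0}) (i : ι) : Ordinal.{0} := ((mkP N code F).run τ).head (Finite.equivFin ι i)

def tp (τ : Ordinal.{0}) (i : ι) : Ordinal.{0} → Bool :=
  ((mkP N code F).run τ).tape (Finite.equivFin ι i)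

def stt (τ : Ordinal.{0}) : Fin (N + 1) := ((mkP N code F).run τ).state

theorem mkP_trans (hi : Function.Injective code) {τ : Ordinal.{0}} {q : St}
    (hq : stt N code F τ = code q) :
    (mkP N code F).trans ((mkP N code F).run τ).state
      ((mkP N code F).readSymbols ((mkP N code F).run τ)) =
      (F q (fun i => tp N code F τ i (hd N code F τ i))).map
    (fun r => (code r.1, fun j => r.2.1 ((Finite.equivFin ι).symm j),
      fun j => r.2.2 ((Finite.equivFin ι).symm j))) := by
  have h1 : ((mkP N code F).run τ).state = code q := hq
  rw [h1]
  show (F (Function.invFun code (code q)) _).map _ = _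
  rw [Function.leftInverse_invFun hi q]
  rfl

theorem mkP_none (hi : Function.Injective code) {τ : Ordinal.{0}} {q : St}
    (hq : stt N code F τ = code q)
    (hF : F q (fun i => tp N code F τ i (hd N code F τ i)) = none) :
    (mkP N code F).haltedAt τ := by
  unfold OTMProgram.haltedAt
  rw [mkP_trans N code F hi hq, hF]; rfl

theorem mkP_some (hi : Function.Injective code) {τ : Ordinal.{0}} {q q' : St}
    {w mv : ι → Bool} (hq : stt N code F τ = code q)
    (hF : F q (fun i => tp N code F τ i (hd N code F τ i)) = some (q', w, mv)) :
    ¬ (mkP N code F).haltedAt τ ∧ stt N code F (τ + 1) = code q' ∧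
      (∀ i, hd N code F (τ + 1) i =
        if mv i then hd N code F τ i + 1 else leftOf (hd N code F τ i)) ∧
      (∀ i x, tp N code F (τ + 1) i x = if x = hd N code F τ i then w i else tp N code F τ i x) := by
  have h := mkP_trans N code F hi hq
  rw [hF, Option.map_some] at h
  refine ⟨?_, ?_, ?_, ?_⟩
  · unfold OTMProgram.haltedAt
    rw [h]; simp
  · unfold stt
    rw [OTMProgram.run_succ]
    unfold OTMProgram.stepConfig
    rw [h]
  · intro i
    unfold hd
    rw [OTMProgram.run_succ]
    unfold OTMProgram.stepConfig
    rw [h]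
    simp
  · intro i x
    unfold tp hd
    rw [OTMProgram.run_succ]
    unfold OTMProgram.stepConfig
    rw [h]
    simp

theorem mkP_lim_head {lam : Ordinal.{0}} (h : Order.IsSuccLimit lam) (i : ι) :
    hd N code F lam i = liminfAt lam (fun σ => hd N code F σ i) :=
  OTMProgram.run_limit_head _ h _

theorem mkP_lim_tape {lam : Ordinal.{0}} (h : Order.IsSuccLimit lam) (i : ι) (x : Ordinal.{0}) :
    tp N code F lam i x = boolLiminfAt lam (fun σ => tp N code F σ i x) :=
  OTMProgram.run_limit_tape _ h _ _

theorem mkP_lim_state {lam : Ordinal.{0}} (h : Order.IsSuccLimit lam) :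
    (((stt N code F lam : Fin (N + 1)) : ℕ) : Ordinal.{0}) =
      liminfAt lam (fun σ => ((stt N code F σ : ℕ) : Ordinal.{0})) :=
  OTMProgram.run_limit_state _ h

end generic

/-! ### Facts about head movement -/

theorem liminf_attained {lam : Ordinal.{0}} (hl : Order.IsSuccLimit lam) (p : Ordinal.{0} → Ordinal.{0})
    (h : ¬ Order.IsSuccLimit (liminfAt lam p)) : ∃ σ < lam, p σ = liminfAt lam p := by
  rcases ord_cases (liminfAt lam p) with h0 | ⟨y, hy⟩ | h1
  · obtain ⟨i, _, hi, hle⟩ := exists_le_liminfAt p hl.bot_lt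
    refine ⟨i, hi, ?_⟩
    rw [h0] at hle ⊢
    exact le_antisymm hle zero_le
  · have : y < liminfAt lam p := by rw [hy]; exact lt_add_one y
    obtain ⟨γ, hγ, hg⟩ := lt_liminfAt.1 this
    obtain ⟨i, hi1, hi, hle⟩ := exists_le_liminfAt p hγ
    refine ⟨i, hi, le_antisymm hle ?_⟩
    rw [hy]
    exact Order.add_one_le_of_lt (hg i hi1 hi)
  · exact absurd h1 h

theorem pred_visited (P : OTMProgram) (t : Fin P.tapes) (τ : Ordinal.{0}) : ∀ y,
    (P.run τ).head t = y + 1 → ∃ σ < τ, (P.run σ).head t = y := by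
  induction τ using WellFoundedLT.induction with
  | ind τ ih =>
  intro y hy
  rcases ord_cases τ with rfl | ⟨σ, rfl⟩ | hl
  · rw [OTMProgram.run_zero] at hy
    exact absurd hy.symm (Order.succ_eq_add_one y ▸ Order.succ_ne_bot y)
  · have hlt : σ < σ + 1 := lt_add_one σ
    rw [OTMProgram.run_succ] at hy
    unfold OTMProgram.stepConfig at hy
    cases hT : P.trans (P.run σ).state (P.readSymbols (P.run σ)) with
    | none =>
      rw [hT] at hy
      obtain ⟨s, hs, h⟩ := ih σ hlt y hy
      exact ⟨s, hs.trans hlt, h⟩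
    | some r =>
      obtain ⟨s', w, mv⟩ := r
      rw [hT] at hy
      dsimp only at hy
      split_ifs at hy with hm
      · refine ⟨σ, hlt, ?_⟩
        rw [← Order.succ_eq_add_one, ← Order.succ_eq_add_one] at hy
        exact Order.succ_injective hy
      · rcases ord_cases ((P.run σ).head t) with h0 | ⟨z, hz⟩ | h1
        · rw [h0, leftOf_zero] at hy
          exact absurd hy.symm (Order.succ_eq_add_one y ▸ Order.succ_ne_bot y)
        · rw [hz, leftOf_add_one] at hy
          obtain ⟨s, hs, h⟩ := ih σ hlt z hz
          rw [hy] at h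
          obtain ⟨s2, hs2, h2⟩ := ih s (hs.trans hlt) y h
          exact ⟨s2, hs2.trans (hs.trans hlt), h2⟩
        · rw [leftOf_limit h1] at hy
          exact absurd hy.symm (Order.succ_eq_add_one y ▸ Order.succ_ne_bot y)
  · rw [OTMProgram.run_limit_head P hl] at hy
    obtain ⟨σ, hσ, h⟩ := liminf_attained hl (fun i => (P.run i).head t) (by
      rw [hy, ← Order.succ_eq_add_one]
      exact Order.not_isSuccLimit_succ y)
    rw [hy] at h
    obtain ⟨s, hs, h2⟩ := ih σ hσ y h
    exact ⟨s, hs.trans hσ, h2⟩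

end Speed

/-! ### Part 5: the accelerated machine -/

namespace Speed

open Classical

/-- index type of the tapes -/
abbrev Ix (P : OTMProgram) (m : ℕ) : Type := Fin P.tapes × (Kd m ⊕ Option (Cl m))

/-- information remembered between the two half-steps -/
abbrev Mem (P : OTMProgram) (m : ℕ) : Type :=
  Fin (P.states + 1) × (Ix P m → Bool) × (Ix P m → Bool)

/-- states of the new machine -/
abbrev Stt (P : OTMProgram) (m k : ℕ) : Type :=
  (Fin (P.states + 1) × Option (Mem P m)) ⊕ Fin (k + 1)

def KK (P : OTMProgram) (m : ℕ) : ℕ := Nat.card (Mem P m) + 1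

def idx (P : OTMProgram) (m : ℕ) : Option (Mem P m) → ℕ
  | none => 0
  | some x => (Finite.equivFin (Mem P m) x : ℕ) + 1

theorem idx_lt (P : OTMProgram) (m : ℕ) (o : Option (Mem P m)) : idx P m o < KK P m := by
  unfold KK
  cases o with
  | none => exact Nat.succ_pos _
  | some x => exact Nat.succ_lt_succ (Finite.equivFin (Mem P m) x).2

theorem idx_inj (P : OTMProgram) (m : ℕ) {o o' : Option (Mem P m)}
    (h : idx P m o = idx P m o') : o = o' := by
  cases o <;> cases o' <;> simp only [idx] at h
  · rfl
  · omega
  · omega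
  · have := Fin.ext (Nat.succ_injective h)
    rw [(Finite.equivFin (Mem P m)).injective this]

def codeN (P : OTMProgram) (m k : ℕ) : Stt P m k → ℕ
  | .inl (s, o) => KK P m * (s : ℕ) + idx P m o
  | .inr j => KK P m * (P.states + 1) + j

theorem codeN_inl_lt (P : OTMProgram) (m : ℕ) (s : Fin (P.states + 1)) (o : Option (Mem P m)) :
    KK P m * (s : ℕ) + idx P m o < KK P m * (P.states + 1) := by
  have h1 := idx_lt P m o
  have h2 : KK P m * ((s : ℕ) + 1) ≤ KK P m * (P.states + 1) := Nat.mul_le_mul_left _ s.2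
  rw [Nat.mul_add] at h2
  omega

def NN (P : OTMProgram) (m k : ℕ) : ℕ := KK P m * (P.states + 1) + k

def code (P : OTMProgram) (m k : ℕ) (q : Stt P m k) : Fin (NN P m k + 1) :=
  ⟨codeN P m k q, by
    unfold NN
    rcases q with ⟨s, o⟩ | j
    · have := codeN_inl_lt P m s o
      simp only [codeN]; omega
    · have := j.2
      simp only [codeN]; omega⟩

theorem code_inj (P : OTMProgram) (m k : ℕ) : Function.Injective (code P m k) := by
  intro q q' h
  have h : codeN P m k q = codeN P m k q' := congrArg Fin.val h
  rcases q with ⟨s, o⟩ | j <;> rcases q' with ⟨s', o'⟩ | j' <;> simp only [codeN] at h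
  · have h1 := idx_lt P m o
    have h2 := idx_lt P m o'
    have hs : (s : ℕ) = s' := by
      have a1 : (KK P m * (s : ℕ) + idx P m o) / KK P m = s := by
        rw [Nat.mul_add_div (by omega), Nat.div_eq_of_lt h1, add_zero]
      have a2 : (KK P m * (s' : ℕ) + idx P m o') / KK P m = s' := by
        rw [Nat.mul_add_div (by omega), Nat.div_eq_of_lt h2, add_zero]
      rw [← a1, ← a2, h]
    rw [hs] at h
    have ho := idx_inj P m (Nat.add_left_cancel h)
    rw [Fin.ext hs, ho]
  · have := codeN_inl_lt P m s o
    omega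
  · have := codeN_inl_lt P m s' o'
    omega
  · rw [Fin.ext (Nat.add_left_cancel h)]

variable {P : OTMProgram} {m k K : ℕ}

/-- the class of the head position on tape `t`, computed from the symbols read -/
def clsR (ρ : Ix P m → Bool) (t : Fin P.tapes) : Cl m :=
  if ρ (t, .inr none) = false then cls m 0
  else if h : ∃ v, ρ (t, .inr (some v)) = true then h.choose
  else if h : ∃ v, ρ (t, .inl (.X v)) = true then h.choose
  else cls m ω

def rep (v : Cl m) : Ordinal.{0} := if h : ∃ x, cls m x = v then h.choose else 0

theorem cls_rep (x : Ordinal.{0}) : cls m (rep (cls m x)) = cls m x := by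
  have h : ∃ y, cls m y = cls m x := ⟨x, rfl⟩
  unfold rep
  rw [dif_pos h]
  exact h.choose_spec

/-- new content under the head -/
def nw (v : Cl m) (w : Bool) : Kd m → Bool
  | .X u => decide (v = u)
  | _ => w

def w1 (ρ : Ix P m → Bool) (w : Fin P.tapes → Bool) : Ix P m → Bool
  | (t, .inl kd) => if sel kd (rep (clsR ρ t)) then nw (clsR ρ t) (w t) kd else ρ (t, .inl kd)
  | (_, .inr none) => true
  | (_, .inr (some _)) => false

def mv1 (ρ : Ix P m → Bool) (mv : Fin P.tapes → Bool) : Ix P m → Bool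
  | (t, .inl kd) => mv t || decide (pos kd (leftOf (rep (clsR ρ t))) = pos kd (rep (clsR ρ t)))
  | (_, .inr _) => false

def mv2 (ρ : Ix P m → Bool) (mv : Fin P.tapes → Bool) : Ix P m → Bool
  | (t, .inl kd) => mv t && !decide (pos kd (rep (clsR ρ t) + 1) = pos kd (rep (clsR ρ t)))
  | (_, .inr _) => false

def yy (ρ : Ix P m → Bool) (mv : Fin P.tapes → Bool) : Ix P m → Bool
  | (_, .inl _) => false
  | (_, .inr none) => true
  | (t, .inr (some u)) => mv t && decide (cls m (rep (clsR ρ t) + 1) = u)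

def w2 (ρ y : Ix P m → Bool) : Ix P m → Bool
  | (t, .inl kd) => ρ (t, .inl kd)
  | (t, .inr o) => y (t, .inr o)

/-- prediction: the simulated machine is going to be halted after `K` steps -/
def dec (K : ℕ) (s : Fin (P.states + 1)) (ρ : Ix P m → Bool) : Prop :=
  ∃ c : OTMConfig P, c.state = s ∧ (∀ t, cls m (c.head t) = clsR ρ t ∧
    Compat (fun kd => ρ (t, .inl kd)) (c.head t) (c.tape t)) ∧ Halted P (P.stepConfig^[K] c)

def FF (P : OTMProgram) (m k K : ℕ) : Stt P m k → (Ix P m → Bool) →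
    Option (Stt P m k × (Ix P m → Bool) × (Ix P m → Bool))
  | .inl (s, none), ρ =>
    if dec K s ρ then some (.inr (Fin.last k), ρ, fun _ => true) else
      (P.trans s (fun t => ρ (t, .inl .M))).map (fun r =>
        (.inl (s, some (r.1, mv2 ρ r.2.2, yy ρ r.2.2)), w1 ρ r.2.1, mv1 ρ r.2.2))
  | .inl (_, some (s', mv, y)), ρ => some (.inl (s', none), w2 ρ y, mv)
  | .inr j, ρ => if (j : ℕ) = 0 then none else
      some (.inr ⟨(j : ℕ) - 1, lt_of_le_of_lt (Nat.sub_le _ _) j.2⟩, ρ, fun _ => true)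

theorem dec_iff (hK : K < m) {s : Fin (P.states + 1)} {ρ : Ix P m → Bool} {c : OTMConfig P}
    (h1 : c.state = s) (h2 : ∀ t, cls m (c.head t) = clsR ρ t ∧
    Compat (fun kd => ρ (t, .inl kd)) (c.head t) (c.tape t)) :
    dec K s ρ ↔ Halted P (P.stepConfig^[K] c) := by
  constructor
  · rintro ⟨c', h1', h2', h3⟩
    refine (LEq.halted (c := c') (c' := c) ⟨h1'.trans h1.symm, fun t => ?_⟩).1 h3
    exact chart hK ((h2' t).1.trans (h2 t).1.symm) (h2' t).2 (h2 t).2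
  · intro h
    exact ⟨c, h1, h2, h⟩

/-! ### the simulation -/

/-- cell `x` was visited before time `τ` by head `t` -/
def vis (P : OTMProgram) (τ : Ordinal.{0}) (t : Fin P.tapes) (x : Ordinal.{0}) : Prop :=
  ∃ σ < τ, (P.run σ).head t = x

/-- intended contents -/
def TT (P : OTMProgram) (τ : Ordinal.{0}) (t : Fin P.tapes) (x : Ordinal.{0}) : Kd m → Bool
  | .X u => decide (vis P τ t x ∧ cls m x = u)
  | _ => (P.run τ).tape t x

theorem TT_data {τ : Ordinal.{0}} {t : Fin P.tapes} {x : Ordinal.{0}} {kd : Kd m}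
    (h : ∀ v, kd ≠ .X v) : TT P τ t x kd = (P.run τ).tape t x := by
  cases kd with
  | X v => exact absurd rfl (h v)
  | _ => rfl

theorem vis_succ {τ : Ordinal.{0}} {t : Fin P.tapes} {x : Ordinal.{0}} :
    vis P (τ + 1) t x ↔ (x = (P.run τ).head t ∨ vis P τ t x) := by
  constructor
  · rintro ⟨σ, hσ, h⟩
    rcases (Order.lt_add_one_iff.1 hσ).lt_or_eq with h1 | rfl
    · exact Or.inr ⟨σ, h1, h⟩
    · exact Or.inl h.symm
  · rintro (rfl | ⟨σ, hσ, h⟩)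
    · exact ⟨τ, lt_add_one τ, rfl⟩
    · exact ⟨σ, hσ.trans (lt_add_one τ), h⟩

theorem TT_zero (t : Fin P.tapes) (x : Ordinal.{0}) (kd : Kd m) : TT P 0 t x kd = false := by
  cases kd with
  | X v =>
    refine decide_eq_false ?_
    rintro ⟨⟨σ, hσ, _⟩, _⟩
    exact absurd hσ not_lt_zero
  | _ =>
    show (P.run 0).tape t x = false
    rw [OTMProgram.run_zero]; rfl

theorem P_step {τ : Ordinal.{0}} {s' : Fin (P.states + 1)} {w mv : Fin P.tapes → Bool}
    (h : P.trans (P.run τ).state (P.readSymbols (P.run τ)) = some (s', w, mv)) :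
    (P.run (τ + 1)).state = s' ∧
    (∀ t, (P.run (τ + 1)).head t =
      if mv t then (P.run τ).head t + 1 else leftOf ((P.run τ).head t)) ∧
    (∀ t x, (P.run (τ + 1)).tape t x =
      if x = (P.run τ).head t then w t else (P.run τ).tape t x) := by
  rw [OTMProgram.run_succ]
  unfold OTMProgram.stepConfig
  rw [h]
  exact ⟨rfl, fun _ => rfl, fun _ _ => rfl⟩

theorem TT_succ {τ : Ordinal.{0}} {s' : Fin (P.states + 1)} {w mv : Fin P.tapes → Bool}
    (h : P.trans (P.run τ).state (P.readSymbols (P.run τ)) = some (s', w, mv))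
    (t : Fin P.tapes) (x : Ordinal.{0}) (kd : Kd m) :
    TT P (τ + 1) t x kd = if x = (P.run τ).head t then
      nw (cls m ((P.run τ).head t)) (w t) kd else TT P τ t x kd := by
  cases kd with
  | X v =>
    simp only [TT, nw, vis_succ]
    split_ifs with hx
    · subst hx; simp
    · simp [hx]
  | _ => exact (P_step h).2.2 t x

theorem TT_lim {lam : Ordinal.{0}} (hl : Order.IsSuccLimit lam)
    (t : Fin P.tapes) (x : Ordinal.{0}) (kd : Kd m) :
    boolLiminfAt lam (fun σ => TT P σ t x kd) = TT P lam t x kd := by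
  cases kd with
  | X v =>
    rw [Bool.eq_iff_iff, boolLiminfAt_true]
    simp only [TT, decide_eq_true_eq]
    constructor
    · rintro ⟨γ, hγ, h⟩
      obtain ⟨⟨σ, hσ, h1⟩, h2⟩ := h γ le_rfl hγ
      exact ⟨⟨σ, hσ.trans hγ, h1⟩, h2⟩
    · rintro ⟨⟨σ, hσ, h1⟩, h2⟩
      exact ⟨σ + 1, add_one_lt_limit hl hσ, fun i hi _ =>
        ⟨⟨σ, lt_of_lt_of_le (lt_add_one σ) hi, h1⟩, h2⟩⟩
  | _ => exact (OTMProgram.run_limit_tape P hl t x).symm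

abbrev QQ (P : OTMProgram) (m k K : ℕ) : OTMProgram := mkP (NN P m k) (code P m k) (FF P m k K)
abbrev hq (P : OTMProgram) (m k K : ℕ) := hd (NN P m k) (code P m k) (FF P m k K)
abbrev tq (P : OTMProgram) (m k K : ℕ) := tp (NN P m k) (code P m k) (FF P m k K)
abbrev sq (P : OTMProgram) (m k K : ℕ) := stt (NN P m k) (code P m k) (FF P m k K)

structure Inv (P : OTMProgram) (m k K : ℕ) (τ : Ordinal.{0}) : Prop where
  st : sq P m k K (2 * τ) = code P m k (.inl ((P.run τ).state, none))
  hl : ∀ t kd, hq P m k K (2 * τ) (t, .inl kd) = pos kd ((P.run τ).head t)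
  hr : ∀ t o, hq P m k K (2 * τ) (t, .inr o) = 0
  tl : ∀ t kd x, sel kd x → tq P m k K (2 * τ) (t, .inl kd) (pos kd x) = TT P τ t x kd
  g : ∀ t, tq P m k K (2 * τ) (t, .inr none) 0 = decide (0 < τ)
  y : ∀ t, (∀ v, tq P m k K (2 * τ) (t, .inr (some v)) 0 = decide (cls m ((P.run τ).head t) = v)) ∨
    ((∀ v, tq P m k K (2 * τ) (t, .inr (some v)) 0 = false) ∧
      (τ = 0 ∨ vis P τ t ((P.run τ).head t) ∨ Order.IsSuccLimit ((P.run τ).head t)))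

structure Mid (P : OTMProgram) (m k K : ℕ) (τ : Ordinal.{0}) : Prop where
  nh : ¬ (QQ P m k K).haltedAt (2 * τ)
  nh' : ¬ (QQ P m k K).haltedAt (2 * τ + 1)
  st : KK P m * ((P.run τ).state : ℕ) ≤ (sq P m k K (2 * τ + 1) : ℕ)
  hl : ∀ t kd, min (pos kd ((P.run τ).head t)) (pos kd ((P.run (τ + 1)).head t)) ≤
    hq P m k K (2 * τ + 1) (t, .inl kd)
  hr : ∀ t o, hq P m k K (2 * τ + 1) (t, .inr o) = 0
  tl : ∀ t kd x, sel kd x → tq P m k K (2 * τ + 1) (t, .inl kd) (pos kd x) = TT P (τ + 1) t x kd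
  g : ∀ t, tq P m k K (2 * τ + 1) (t, .inr none) 0 = true
  y : ∀ t v, tq P m k K (2 * τ + 1) (t, .inr (some v)) 0 = false

abbrev rd (P : OTMProgram) (m k K : ℕ) (σ : Ordinal.{0}) : Ix P m → Bool :=
  fun i => tq P m k K σ i (hq P m k K σ i)

theorem inv_zero (hm : 0 < m) : Inv P m k K 0 := by
  have h0 : (QQ P m k K).run (2 * 0) = (QQ P m k K).initConfig := by
    rw [mul_zero]; exact OTMProgram.run_zero _
  have hp : ∀ t, (P.run 0).head t = 0 := by
    intro t; rw [OTMProgram.run_zero]; rfl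
  have ht : ∀ i x, tq P m k K (2 * 0) i x = false := by
    intro i x
    show ((QQ P m k K).run (2 * 0)).tape _ x = false
    rw [h0]; rfl
  have hh : ∀ i, hq P m k K (2 * 0) i = 0 := by
    intro i
    show ((QQ P m k K).run (2 * 0)).head _ = 0
    rw [h0]; rfl
  refine ⟨?_, ?_, ?_, ?_, ?_, ?_⟩
  · show ((QQ P m k K).run (2 * 0)).state = _
    rw [h0, OTMProgram.run_zero]
    apply Fin.ext
    show 0 = KK P m * 0 + 0
    simp
  · intro t kd
    rw [hp, pos_zero hm, hh]
  · intro t o; exact hh _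
  · intro t kd x _
    rw [TT_zero, ht]
  · intro t
    rw [ht]; simp
  · intro t
    exact Or.inr ⟨fun v => ht _ _, Or.inl rfl⟩

theorem Inv.rd_inl {τ : Ordinal.{0}} (h : Inv P m k K τ) (t : Fin P.tapes) (kd : Kd m) :
    rd P m k K (2 * τ) (t, .inl kd) =
      tq P m k K (2 * τ) (t, .inl kd) (pos kd ((P.run τ).head t)) := by
  show tq P m k K (2 * τ) _ (hq P m k K (2 * τ) _) = _
  rw [h.hl]

theorem Inv.rd_inr {τ : Ordinal.{0}} (h : Inv P m k K τ) (t : Fin P.tapes) (o : Option (Cl m)) :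
    rd P m k K (2 * τ) (t, .inr o) = tq P m k K (2 * τ) (t, .inr o) 0 := by
  show tq P m k K (2 * τ) _ (hq P m k K (2 * τ) _) = _
  rw [h.hr]

theorem Inv.cls (hm : 0 < m) {τ : Ordinal.{0}} (h : Inv P m k K τ) (t : Fin P.tapes) :
    clsR (rd P m k K (2 * τ)) t = Speed.cls m ((P.run τ).head t) := by
  unfold clsR
  rw [h.rd_inr, h.g]
  by_cases h0 : τ = 0
  · subst h0
    rw [if_pos (by simp), OTMProgram.run_zero]
    rfl
  have hpos : 0 < τ := pos_iff_ne_zero.2 h0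
  rw [if_neg (by simp [hpos])]
  rcases h.y t with hy | ⟨hy, hv⟩
  · have hex : ∃ v, rd P m k K (2 * τ) (t, .inr (some v)) = true :=
      ⟨Speed.cls m ((P.run τ).head t), by rw [h.rd_inr, hy]; simp⟩
    rw [dif_pos hex]
    have := hex.choose_spec
    rw [h.rd_inr, hy, decide_eq_true_eq] at this
    exact this.symm
  · rw [dif_neg (by
      rintro ⟨v, hv⟩
      rw [h.rd_inr, hy] at hv
      exact Bool.false_ne_true hv)]
    have hX : ∀ v, rd P m k K (2 * τ) (t, .inl (.X v)) =
        decide (vis P τ t ((P.run τ).head t) ∧ Speed.cls m ((P.run τ).head t) = v) := by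
      intro v
      rw [h.rd_inl, h.tl t (.X v) _ trivial]
      rfl
    by_cases hvis : vis P τ t ((P.run τ).head t)
    · have hex : ∃ v, rd P m k K (2 * τ) (t, .inl (.X v)) = true :=
        ⟨Speed.cls m ((P.run τ).head t), by rw [hX]; simp [hvis]⟩
      rw [dif_pos hex]
      have := hex.choose_spec
      rw [hX, decide_eq_true_eq] at this
      exact this.2.symm
    · rw [dif_neg (by
        rintro ⟨v, hv⟩
        rw [hX, decide_eq_true_eq] at hv
        exact hvis hv.1)]
      rcases hv with hv | hv | hv
      · exact absurd hv h0
      · exact absurd hv hvis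
      · exact cls_limit hm Ordinal.isSuccLimit_omega0 hv

theorem Inv.dec_iff (hK : K < m) {τ : Ordinal.{0}} (h : Inv P m k K τ) :
    dec K (P.run τ).state (rd P m k K (2 * τ)) ↔ P.haltedAt (τ + K) := by
  rw [Speed.dec_iff hK rfl (c := P.run τ)]
  · have : ∀ j : ℕ, P.stepConfig^[j] (P.run τ) = P.run (τ + j) := by
      intro j
      induction j with
      | zero => simp
      | succ j ih =>
        rw [Function.iterate_succ_apply', ih, Nat.cast_succ, ← add_assoc, OTMProgram.run_succ]
    rw [this]; rfl
  · intro t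
    refine ⟨(h.cls (by omega) t).symm, ?_⟩
    intro kd x hkd hs hp
    dsimp only
    rw [h.rd_inl, ← hp, h.tl t kd x hs, TT_data hkd]

theorem Inv.readM {τ : Ordinal.{0}} (h : Inv P m k K τ) :
    (fun t => rd P m k K (2 * τ) (t, .inl .M)) = P.readSymbols (P.run τ) := by
  funext t
  rw [h.rd_inl, h.tl t .M _ trivial]
  rfl

end Speed

namespace Speed

open Classical

variable {P : OTMProgram} {m k K : ℕ}

theorem Inv.step (hK : K < m) {τ : Ordinal.{0}} (h : Inv P m k K τ)
    (hn : ¬ P.haltedAt τ) (hd : ¬ P.haltedAt (τ + K)) : Mid P m k K τ ∧ Inv P m k K (τ + 1) := by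
  have hm : 0 < m := by omega
  have hdec := mt (h.dec_iff hK).1 hd
  obtain ⟨⟨s', w, mv⟩, hT⟩ := Option.ne_none_iff_exists'.1 hn
  obtain ⟨p1, p2, p3⟩ := P_step hT
  set ρ := rd P m k K (2 * τ) with hρ
  have hF : FF P m k K (.inl ((P.run τ).state, none)) ρ =
      some (.inl ((P.run τ).state, some (s', mv2 ρ mv, yy ρ mv)), w1 ρ w, mv1 ρ mv) := by
    simp only [FF]
    rw [if_neg hdec, h.readM, hT]
    rfl
  obtain ⟨a0, a1, a2, a3⟩ := mkP_some _ _ _ (code_inj P m k) h.st hF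
  replace a2 : ∀ i, hq P m k K (2 * τ + 1) i = if mv1 ρ mv i then hq P m k K (2 * τ) i + 1
    else leftOf (hq P m k K (2 * τ) i) := a2
  replace a3 : ∀ i x, tq P m k K (2 * τ + 1) i x =
    if x = hq P m k K (2 * τ) i then w1 ρ w i else tq P m k K (2 * τ) i x := a3
  set ρ' := rd P m k K (2 * τ + 1) with hρ'
  have hF' : FF P m k K (.inl ((P.run τ).state, some (s', mv2 ρ mv, yy ρ mv))) ρ' =
      some (.inl (s', none), w2 ρ' (yy ρ mv), mv2 ρ mv) := by
    simp only [FF]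
  obtain ⟨b0, b1, b2, b3⟩ := mkP_some _ _ _ (code_inj P m k) a1 hF'
  rw [← two_mul_succ] at b1 b2 b3
  replace b2 : ∀ i, hq P m k K (2 * (τ + 1)) i = if mv2 ρ mv i then hq P m k K (2 * τ + 1) i + 1
    else leftOf (hq P m k K (2 * τ + 1) i) := b2
  replace b3 : ∀ i x, tq P m k K (2 * (τ + 1)) i x =
    if x = hq P m k K (2 * τ + 1) i then w2 ρ' (yy ρ mv) i else tq P m k K (2 * τ + 1) i x := b3
  have hcl : ∀ t, Speed.cls m (rep (clsR ρ t)) = Speed.cls m ((P.run τ).head t) := by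
    intro t
    rw [h.cls hm t]
    exact cls_rep _
  -- heads at the middle
  have mhl : ∀ t kd, hq P m k K (2 * τ + 1) (t, .inl kd) =
      if mv1 ρ mv (t, .inl kd) then pos kd ((P.run τ).head t) + 1
      else leftOf (pos kd ((P.run τ).head t)) := by
    intro t kd
    rw [a2, h.hl]
  have mhr : ∀ t o, hq P m k K (2 * τ + 1) (t, .inr o) = 0 := by
    intro t o
    rw [a2, h.hr]
    simp [mv1, leftOf_zero]
  have mtl : ∀ t kd x, sel kd x →
      tq P m k K (2 * τ + 1) (t, .inl kd) (pos kd x) = TT P (τ + 1) t x kd := by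
    intro t kd x hs
    rw [a3, h.hl, TT_succ hT]
    by_cases hx : x = (P.run τ).head t
    · subst hx
      rw [if_pos rfl, if_pos rfl]
      simp only [w1]
      rw [if_pos ((sel_congr hm kd (hcl t)).2 hs), h.cls hm t]
    · rw [if_neg hx]
      by_cases hp : pos kd x = pos kd ((P.run τ).head t)
      · rw [if_pos hp]
        have hns : ¬ sel kd ((P.run τ).head t) := fun hs' => hx (sel_inj hm kd hs hs' hp)
        simp only [w1]
        rw [if_neg (fun h' => hns ((sel_congr hm kd (hcl t)).1 h')), hρ, h.rd_inl, ← hp,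
          h.tl t kd x hs]
      · rw [if_neg hp, h.tl t kd x hs]
  have mg : ∀ t, tq P m k K (2 * τ + 1) (t, .inr none) 0 = true := by
    intro t
    rw [a3, h.hr, if_pos rfl]; rfl
  have my : ∀ t v, tq P m k K (2 * τ + 1) (t, .inr (some v)) 0 = false := by
    intro t v
    rw [a3, h.hr, if_pos rfl]; rfl
  -- heads at the end
  have ehl : ∀ t kd, hq P m k K (2 * (τ + 1)) (t, .inl kd) = pos kd ((P.run (τ + 1)).head t) := by
    intro t kd
    rw [b2, mhl, p2]
    cases hmv : mv t with
    | true =>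
      simp only [mv1, mv2, hmv, Bool.true_or, Bool.true_and, if_true]
      rcases pos_succ hm kd ((P.run τ).head t) with he | he
      · have := (stayR_congr hm kd (hcl t)).2 he
        simp [this, leftOf_add_one, he]
      · have hne : pos kd ((P.run τ).head t + 1) ≠ pos kd ((P.run τ).head t) := by
          rw [he]
          exact ((lt_add_one _).trans (lt_add_one _)).ne'
        have := mt (stayR_congr hm kd (hcl t)).1 hne
        simp [this, he]
    | false =>
      simp only [mv1, mv2, hmv, Bool.false_or, Bool.false_and, if_false, Bool.false_eq_true]
      by_cases he : pos kd (leftOf ((P.run τ).head t)) = pos kd ((P.run τ).head t)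
      · have := (stayL_congr hm kd (hcl t)).2 he
        simp [this, leftOf_add_one, he]
      · have := mt (stayL_congr hm kd (hcl t)).1 he
        rcases pos_left hm kd ((P.run τ).head t) with he' | he'
        · exact absurd he' he
        · simp [this, he']
  refine ⟨⟨a0, b0, ?_, ?_, mhr, mtl, mg, my⟩, ⟨?_, ehl, ?_, ?_, ?_, ?_⟩⟩
  · show _ ≤ ((stt _ _ _ _ : Fin _) : ℕ)
    rw [a1]
    exact Nat.le_add_right _ _
  · intro t kd
    rw [mhl, p2]
    cases hmv : mv t with
    | true =>
      simp only [mv1, hmv, Bool.true_or, if_true]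
      exact (min_le_left _ _).trans (lt_add_one _).le
    | false =>
      simp only [mv1, hmv, Bool.false_or, Bool.false_eq_true, if_false]
      by_cases he : pos kd (leftOf ((P.run τ).head t)) = pos kd ((P.run τ).head t)
      · have := (stayL_congr hm kd (hcl t)).2 he
        simp only [this, decide_true, if_true]
        exact (min_le_left _ _).trans (lt_add_one _).le
      · have := mt (stayL_congr hm kd (hcl t)).1 he
        rcases pos_left hm kd ((P.run τ).head t) with he' | he'
        · exact absurd he' he
        · simp only [this, decide_false, Bool.false_eq_true, if_false]
          rw [he']
          exact (min_le_right _ _).trans (leftOf_le _)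
  · rw [p1]; exact b1
  · intro t o
    rw [b2, mhr]
    simp [mv2, leftOf_zero]
  · intro t kd x hs
    rw [b3]
    split_ifs with hx
    · rw [← mtl t kd x hs, hx]; rfl
    · exact mtl t kd x hs
  · intro t
    rw [b3, mhr, if_pos rfl]
    simp [w2, yy]
  · intro t
    have hyv : ∀ v, tq P m k K (2 * (τ + 1)) (t, .inr (some v)) 0 =
        (mv t && decide (Speed.cls m (rep (clsR ρ t) + 1) = v)) := by
      intro v
      rw [b3, mhr, if_pos rfl]; rfl
    cases hmv : mv t with
    | true =>
      left
      intro v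
      rw [hyv, p2, hmv, cls_succ hm (hcl t)]
      simp
    | false =>
      right
      refine ⟨fun v => by rw [hyv, hmv]; rfl, Or.inr (Or.inl ?_)⟩
      rw [p2, hmv, if_neg (by simp)]
      have h00 : vis P (τ + 1) t 0 :=
        ⟨0, lt_of_le_of_lt zero_le (lt_add_one τ), by rw [OTMProgram.run_zero]; rfl⟩
      rcases ord_cases ((P.run τ).head t) with h0 | ⟨z, hz⟩ | h1
      · rw [h0, leftOf_zero]; exact h00
      · rw [hz, leftOf_add_one]
        obtain ⟨σ, hσ, hh⟩ := pred_visited P t τ z hz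
        exact ⟨σ, hσ.trans (lt_add_one τ), hh⟩
      · rw [leftOf_limit h1]; exact h00

theorem hq_lim {lam : Ordinal.{0}} (h : Order.IsSuccLimit lam) (i : Ix P m) :
    hq P m k K lam i = liminfAt lam (fun σ => hq P m k K σ i) :=
  mkP_lim_head _ _ _ h i

theorem tq_lim {lam : Ordinal.{0}} (h : Order.IsSuccLimit lam) (i : Ix P m) (x : Ordinal.{0}) :
    tq P m k K lam i x = boolLiminfAt lam (fun σ => tq P m k K σ i x) :=
  mkP_lim_tape _ _ _ h i x

theorem inv_limit (hm : 0 < m) {lam : Ordinal.{0}} (hl : Order.IsSuccLimit lam)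
    (h : ∀ σ < lam, Inv P m k K σ ∧ Mid P m k K σ) : Inv P m k K lam := by
  have e2 : 2 * lam = lam := two_mul_limit hl
  refine ⟨?_, ?_, ?_, ?_, ?_, ?_⟩
  · rw [e2]
    apply Fin.ext
    have h1 := mkP_lim_state (NN P m k) (code P m k) (FF P m k K) hl
    rw [liminf_transfer (f := fun x => ((KK P m : ℕ) : Ordinal.{0}) * x)
      (p := fun σ => (((P.run σ).state : ℕ) : Ordinal.{0})) hl, ← OTMProgram.run_limit_state P hl] at h1
    · have h1 : _ = ((KK P m : ℕ) : Ordinal.{0}) * _ := h1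
      rw [← Ordinal.natCast_mul, Nat.cast_inj] at h1
      exact h1
    · intro a b hab
      exact mul_le_mul_right hab _
    · intro l hl y hy
      exact (Ordinal.lt_mul_iff_of_isSuccLimit hl).1 hy
    · intro σ hσ
      have := (h σ hσ).1.st
      show (((sq P m k K (2 * σ) : Fin _) : ℕ) : Ordinal.{0}) = _
      rw [this, ← Ordinal.natCast_mul]
      rfl
    · intro σ hσ
      refine (min_le_left _ _).trans ?_
      rw [← Ordinal.natCast_mul, Nat.cast_le]
      exact (h σ hσ).2.st
  · intro t kd
    rw [e2, OTMProgram.run_limit_head P hl, hq_lim hl]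
    exact liminf_transfer hl (pos_mono hm kd) (pos_cont hm kd)
      (fun σ hσ => (h σ hσ).1.hl t kd) (fun σ hσ => (h σ hσ).2.hl t kd)
  · intro t o
    rw [e2, hq_lim hl]
    rw [liminf_transfer (f := fun x => x) (p := fun _ => 0) hl monotone_id
      (fun l _ y hy => ?_)
      (fun σ hσ => (h σ hσ).1.hr t o) (fun σ hσ => by simp)]
    · obtain ⟨i, _, _, hi⟩ := exists_le_liminfAt (lam := lam) (fun _ => 0) hl.bot_lt
      refine le_antisymm ?_ zero_le
      by_contra hc
      rw [not_le, lt_liminfAt] at hc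
      obtain ⟨γ, hγ, hg⟩ := hc
      exact lt_irrefl _ (hg γ le_rfl hγ)
    · exact ⟨y + 1, add_one_lt_limit (by assumption) hy, lt_add_one y⟩
  · intro t kd x hs
    rw [e2, tq_lim hl, ← TT_lim hl]
    exact boolLiminf_transfer hl (fun σ hσ => (h σ hσ).1.tl t kd x hs)
      (fun σ hσ => (h σ hσ).2.tl t kd x hs)
  · intro t
    rw [e2, tq_lim hl]
    rw [boolLiminf_transfer (p := fun σ => decide (0 < σ)) hl (fun σ hσ => (h σ hσ).1.g t)
      (fun σ hσ => by rw [(h σ hσ).2.g t]; simp)]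
    rw [Bool.eq_iff_iff, boolLiminfAt_true]
    have h1 : (0 : Ordinal.{0}) < lam := hl.bot_lt
    have h2 : (0 : Ordinal.{0}) + 1 < lam := add_one_lt_limit hl h1
    rw [zero_add] at h2
    simp only [decide_eq_true_eq, h1, iff_true]
    exact ⟨1, h2, fun i hi _ => lt_of_lt_of_le zero_lt_one hi⟩
  · intro t
    right
    refine ⟨fun v => ?_, Or.inr ?_⟩
    · rw [e2, tq_lim hl, ← Bool.not_eq_true, boolLiminfAt_true]
      rintro ⟨γ, hγ, hg⟩
      have h1 := hg (2 * γ + 1) ((le_two_mul γ).trans (lt_add_one _).le)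
        (add_one_lt_limit hl (two_mul_lt hl hγ))
      have h2 := (h γ hγ).2.y t v
      exact Bool.false_ne_true (h2.symm.trans h1)
    · by_cases hL : Order.IsSuccLimit ((P.run lam).head t)
      · exact Or.inr hL
      · left
        rw [OTMProgram.run_limit_head P hl] at hL ⊢
        exact liminf_attained hl _ hL

/-- the invariant holds along the whole run -/
theorem inv_all (hK : K < m) {lam : Ordinal.{0}} (h1 : ∀ σ < lam, ¬ P.haltedAt σ)
    (h2 : ∀ σ < lam, ¬ P.haltedAt (σ + K)) (τ : Ordinal.{0}) : τ ≤ lam →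
    Inv P m k K τ ∧ (τ < lam → Mid P m k K τ) := by
  induction τ using WellFoundedLT.induction with
  | ind τ ih =>
  intro hτ
  suffices hI : Inv P m k K τ from ⟨hI, fun hlt => (hI.step hK (h1 τ hlt) (h2 τ hlt)).1⟩
  rcases ord_cases τ with rfl | ⟨σ, rfl⟩ | hl
  · exact inv_zero (by omega)
  · have hs : σ < lam := lt_of_lt_of_le (lt_add_one σ) hτ
    exact ((ih σ (lt_add_one σ) hs.le).1.step hK (h1 σ hs) (h2 σ hs)).2
  · refine inv_limit (by omega) hl (fun σ hσ => ?_)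
    have := ih σ hσ (hσ.le.trans hτ)
    exact ⟨this.1, this.2 (lt_of_lt_of_le hσ hτ)⟩

theorem count_run (j : ℕ) : ∀ (hj : j < k + 1) {σ : Ordinal.{0}},
    sq P m k K σ = code P m k (.inr ⟨j, hj⟩) →
    (QQ P m k K).haltedAt (σ + j) ∧ ∀ i < j, ¬ (QQ P m k K).haltedAt (σ + (i : ℕ)) := by
  induction j with
  | zero =>
    intro hj σ hs
    refine ⟨?_, fun i hi => absurd hi (Nat.not_lt_zero i)⟩
    rw [Nat.cast_zero, add_zero]
    exact mkP_none _ _ _ (code_inj P m k) hs (by simp [FF])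
  | succ j ih =>
    intro hj σ hs
    have hF : FF P m k K (.inr ⟨j + 1, hj⟩) (rd P m k K σ) =
        some (.inr ⟨j, by omega⟩, rd P m k K σ, fun _ => true) := by
      simp [FF]
    obtain ⟨a0, a1, _, _⟩ := mkP_some _ _ _ (code_inj P m k) hs hF
    obtain ⟨b1, b2⟩ := ih (by omega) a1
    have e : ∀ i : ℕ, σ + 1 + (i : Ordinal.{0}) = σ + ((i + 1 : ℕ) : Ordinal.{0}) := by
      intro i
      rw [add_assoc, add_comm i 1, Nat.cast_add, Nat.cast_one]
    refine ⟨by rw [← e]; exact b1, fun i hi => ?_⟩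
    rcases i with _ | i
    · rw [Nat.cast_zero, add_zero]; exact a0
    · rw [← e]; exact b2 i (by omega)

theorem speed (P : OTMProgram) (a : Ordinal.{0}) (k n : ℕ)
    (h : P.haltsAt (ω * a + k + n + 1)) : (QQ P (k + n + 2) k (k + n + 1)).haltsAt (ω * a + k + 1) := by
  set lam := ω * a with hlam
  have elam : 2 * lam = lam := by
    rcases eq_or_ne a 0 with h0 | h0
    · rw [hlam, h0]; simp
    · have := form_limit h0
      rw [Nat.cast_zero, add_zero] at this
      exact two_mul_limit this
  have eK : lam + k + n + 1 = lam + ((k + n + 1 : ℕ) : Ordinal.{0}) := by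
    push_cast
    simp only [add_assoc]
  rw [eK] at h
  obtain ⟨hh, hno⟩ := h
  have hlt : ∀ σ < lam, σ + ((k + n + 1 : ℕ) : Ordinal.{0}) < lam := by
    intro σ hσ
    obtain ⟨b, j, rfl⟩ := form σ
    have hb : b < a := by
      by_contra hc
      have : ω * a ≤ ω * b := mul_le_mul_right (not_lt.1 hc) _
      exact absurd (lt_of_lt_of_le hσ (this.trans le_self_add)) (lt_irrefl _)
    rw [add_assoc, ← Nat.cast_add]
    exact form_lt hb _
  have hno1 : ∀ σ < lam, ¬ P.haltedAt σ := fun σ hσ =>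
    hno σ (lt_of_lt_of_le hσ le_self_add)
  have hall := inv_all (P := P) (m := k + n + 2) (k := k) (K := k + n + 1) (by omega) hno1
    (fun σ hσ => hno1 _ (hlt σ hσ))
  have hI := (hall lam le_rfl).1
  have hdec := (hI.dec_iff (by omega)).2 hh
  have hF : FF P (k + n + 2) k (k + n + 1) (.inl ((P.run lam).state, none))
      (rd P (k + n + 2) k (k + n + 1) (2 * lam)) =
      some (.inr (Fin.last k), rd P (k + n + 2) k (k + n + 1) (2 * lam), fun _ => true) := by
    simp only [FF]
    rw [if_pos hdec]
  obtain ⟨a0, a1, _, _⟩ := mkP_some _ _ _ (code_inj P _ k) hI.st hF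
  rw [elam] at a0 a1
  obtain ⟨b1, b2⟩ := count_run k (by omega) a1
  have e1 : ∀ i : ℕ, lam + 1 + (i : Ordinal.{0}) = lam + (i : Ordinal.{0}) + 1 := by
    intro i
    rw [add_assoc, add_assoc, ← Nat.cast_one, ← Nat.cast_add, ← Nat.cast_add, add_comm i 1]
  refine ⟨by rw [← e1]; exact b1, fun σ hσ => ?_⟩
  by_cases hs : σ < lam
  · obtain ⟨ρ, rfl | rfl⟩ := half_cases σ
    · have : ρ < lam := lt_of_le_of_lt (le_two_mul ρ) hs
      exact ((hall ρ this.le).2 this).nh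
    · have : ρ < lam := lt_of_le_of_lt ((le_two_mul ρ).trans (lt_add_one _).le) hs
      exact ((hall ρ this.le).2 this).nh'
  · obtain ⟨d, rfl⟩ := exists_add_of_le (not_lt.1 hs)
    rw [add_assoc, add_lt_add_iff_left] at hσ
    have : d < ω := hσ.trans (by
      rw [← Nat.cast_succ]; exact Ordinal.natCast_lt_omega0 _)
    obtain ⟨i, rfl⟩ := Ordinal.lt_omega0.1 this
    rw [← Nat.cast_succ, Nat.cast_lt] at hσ
    rcases i with _ | i
    · rw [Nat.cast_zero, add_zero]; exact a0
    · have := b2 i (by omega)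
      rw [Nat.cast_succ, ← add_assoc, ← e1]; exact this

end Speed

/-- Speedup: if `α + n` is OTM-clockable for a natural number `n`, so is `α`. -/
theorem otm_clockable_speedup (α : Ordinal.{0}) (n : ℕ)
    (h : OTMClockable (α + n)) : OTMClockable α := by
  obtain ⟨P, hP⟩ := h
  obtain ⟨a, k, rfl⟩ := Speed.form α
  exact ⟨_, Speed.speed P a k n hP⟩

end
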